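/- arXiv:2409.04012 — 4 statements merged into one kernel-verified Lean document; each statement's English description precedes it below -/
import Mathlib

section
/- Let X₁ and X₂ be nonempty compact subsets of Hausdorff topological spaces, and let F = [f̲, f̄] : X₁ × X₂ → I(ℝ) be a continuous interval-valued function (i.e. f̲, f̄ : X₁ × X₂ → ℝ are continuous with f̲ ≤ f̄ pointwise). Define the set-valued mapping Φ : X₂ ⇉ X₁ by Φ(y) = { x ∈ X₁ : for all u ∈ X₁, NOT ( f̲(x,y) < f̲(u,y) and f̄(x,y) < f̄(u,y) ) }. Then for every y ∈ X₂ the set Φ(y) is nonempty and compact, and Φ is upper semicontinuous: for every y ∈ X₂ and every open set V ⊇ Φ(y) there is an open neighborhood O of y such that Φ(y') ⊆ V for all y' ∈ O ∩ X₂. -/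
open Set Filter Topology in
/-- Lemma 2.4 of the paper.
Let `X₁`, `X₂` be nonempty compact subsets of Hausdorff topological spaces and let
`F = [fl, fu] : X₁ × X₂ → I(ℝ)` be a continuous interval-valued function (both endpoint
functions continuous, `fl ≤ fu`).  Define `Φ y` to be the set of `x ∈ X₁` whose interval
value `F(x, y)` is not strictly dominated from below by any `F(u, y)` with `u ∈ X₁`.
Then each `Φ y` (for `y ∈ X₂`) is nonempty and compact, and `Φ` is upper semicontinuous
on `X₂`. -/
theorem stmt_0 {α β : Type*} [TopologicalSpace α] [TopologicalSpace β]
    [T2Space α] [T2Space β]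
    (X₁ : Set α) (X₂ : Set β)
    (hX₁c : IsCompact X₁) (hX₂c : IsCompact X₂)
    (hX₁ne : X₁.Nonempty) (hX₂ne : X₂.Nonempty)
    (fl fu : α × β → ℝ)
    (hfl : ContinuousOn fl (X₁ ×ˢ X₂)) (hfu : ContinuousOn fu (X₁ ×ˢ X₂))
    (hle : ∀ p ∈ X₁ ×ˢ X₂, fl p ≤ fu p)
    (Φ : β → Set α)
    (hΦ : ∀ y, Φ y =
      {x ∈ X₁ | ∀ u ∈ X₁, ¬ (fl (x, y) < fl (u, y) ∧ fu (x, y) < fu (u, y))}) :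
    (∀ y ∈ X₂, (Φ y).Nonempty ∧ IsCompact (Φ y)) ∧
    (∀ y ∈ X₂, ∀ V : Set α, IsOpen V → Φ y ⊆ V →
      ∃ O : Set β, IsOpen O ∧ y ∈ O ∧ ∀ y' ∈ O ∩ X₂, Φ y' ⊆ V) := by
  have key : ∀ x ∈ X₁, ∀ y ∈ X₂, x ∉ Φ y →
      ∀ᶠ p in 𝓝[X₁] x ×ˢ 𝓝[X₂] y, p.1 ∉ Φ p.2 := by
    intro x hx y hy hn
    have hu : ∃ u ∈ X₁, fl (x, y) < fl (u, y) ∧ fu (x, y) < fu (u, y) := by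
      by_contra hcon
      apply hn
      rw [hΦ]
      exact ⟨hx, fun u hu h => hcon ⟨u, hu, h⟩⟩
    obtain ⟨u, hu, h1, h2⟩ := hu
    rw [← nhdsWithin_prod_eq]
    have hmap : Tendsto (fun p : α × β => (u, p.2)) (𝓝[X₁ ×ˢ X₂] (x, y))
        (𝓝[X₁ ×ˢ X₂] (u, y)) := by
      refine tendsto_nhdsWithin_iff.mpr ⟨?_, ?_⟩
      · exact (Continuous.tendsto (by fun_prop) (x, y)).mono_left nhdsWithin_le_nhds
      · filter_upwards [self_mem_nhdsWithin] with p hp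
        exact ⟨hu, hp.2⟩
    have a1 := (hfl (x, y) ⟨hx, hy⟩).tendsto.eventually_lt
      ((hfl (u, y) ⟨hu, hy⟩).tendsto.comp hmap) h1
    have a2 := (hfu (x, y) ⟨hx, hy⟩).tendsto.eventually_lt
      ((hfu (u, y) ⟨hu, hy⟩).tendsto.comp hmap) h2
    filter_upwards [a1, a2] with p b1 b2 hp
    rw [hΦ] at hp
    exact hp.2 u hu ⟨b1, b2⟩
  have hsub : ∀ y, Φ y ⊆ X₁ := by
    intro y x hx
    rw [hΦ] at hx
    exact hx.1
  refine ⟨fun y hy => ⟨?_, ?_⟩, ?_⟩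
  · have hc : ContinuousOn (fun x => fl (x, y)) X₁ :=
      hfl.comp (by fun_prop) (fun x hx => ⟨hx, hy⟩)
    obtain ⟨x, hx, hmax⟩ := hX₁c.exists_isMaxOn hX₁ne hc
    refine ⟨x, ?_⟩
    rw [hΦ]
    exact ⟨hx, fun u hu h => absurd (hmax hu) (not_le.mpr h.1)⟩
  · refine hX₁c.of_isClosed_subset ?_ (hsub y)
    rw [← isOpen_compl_iff, isOpen_iff_mem_nhds]
    intro x hx
    by_cases hxX : x ∈ X₁
    · have h := (key x hxX y hy hx).curry
      have h' : ∀ᶠ a in 𝓝[X₁] x, a ∉ Φ y :=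
        h.mono fun a ha => ha.self_of_nhdsWithin hy
      rw [eventually_nhdsWithin_iff] at h'
      filter_upwards [h'] with a ha hm
      exact ha (hsub y hm) hm
    · filter_upwards [hX₁c.isClosed.isOpen_compl.mem_nhds hxX] with a ha hm
      exact ha (hsub y hm)
  · intro y hy V hV hsubV
    have hK : IsCompact (X₁ \ V) := hX₁c.diff hV
    have main : ∀ᶠ y' in 𝓝[X₂] y, ∀ x ∈ X₁ \ V, x ∉ Φ y' := by
      refine hK.induction_on (p := fun s => ∀ᶠ y' in 𝓝[X₂] y, ∀ x ∈ s, x ∉ Φ y') ?_ ?_ ?_ ?_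
      · simp
      · intro s t hst ht
        exact ht.mono fun y' h x hx => h x (hst hx)
      · intro s t hs ht
        filter_upwards [hs, ht] with y' h1 h2 x hx
        exact hx.elim (h1 x) (h2 x)
      · intro x hx
        obtain ⟨pa, ha, pb, hb, hab⟩ :=
          eventually_prod_iff.mp (key x hx.1 y hy fun h => hx.2 (hsubV h))
        refine ⟨{a | pa a}, nhdsWithin_mono x sdiff_subset ha, ?_⟩
        filter_upwards [hb] with y' hy' a haa
        exact hab haa hy'
    obtain ⟨O, hO, hyO, hOs⟩ := mem_nhdsWithin.mp main
    refine ⟨O, hO, hyO, fun y' hy' x hx => ?_⟩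
    by_contra hxV
    exact hOs hy' x ⟨hsub y' hx, hxV⟩ hx
end

section
/- Consider an n-player multi-objective interval game in which, for each player i ∈ {1,…,n}, the strategy set Uᵢ is a nonempty, convex, compact subset of the Banach space C([t₀,t₁]; ℝ^{mᵢ}) of continuous functions with the supremum norm, and the payoff of player i is an interval-vector-valued function Jᵢ = (Jᵢ₁, …, J_{i,dᵢ}) : U₁ × ⋯ × Uₙ → I(ℝ)^{dᵢ}, each component Jᵢₖ = [J̲ᵢₖ, J̄ᵢₖ] being an interval-valued function (in particular, the payoffs induced by a multi-objective interval differential game). Suppose that for each player i there exists an index kᵢ ∈ {1,…,dᵢ} such that: (i) Jᵢ_{kᵢ} is continuous (both endpoint functions J̲ᵢ_{kᵢ} and J̄ᵢ_{kᵢ} are continuous on the product space); (ii) for each fixed u₋ᵢ, the map uᵢ ↦ Jᵢ_{kᵢ}(uᵢ, u₋ᵢ) is generalized I(ℝ₊)-quasi-concave on Uᵢ. Then there exists an open-loop Pareto-Nash equilibrium u* = (u₁*, …, uₙ*) ∈ U₁ × ⋯ × Uₙ, i.e., for every i and every uᵢ ∈ Uᵢ there exists k ∈ {1,…,dᵢ}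 with J̲ᵢₖ(uᵢ, u*₋ᵢ) ≤ J̲ᵢₖ(u*) or J̄ᵢₖ(uᵢ, u*₋ᵢ) ≤ J̄ᵢₖ(u*). -/
/-- exactly one colliding pair -/
lemma collide {α β : Type*} [DecidableEq α] [DecidableEq β] (f : α → β) (S : Finset α)
    (h : S.card = (S.image f).card + 1) :
    ∃ a ∈ S, ∃ b ∈ S, a ≠ b ∧ f a = f b ∧
      ∀ x ∈ S, ∀ y ∈ S, f x = f y → x ≠ y → (x = a ∧ y = b) ∨ (x = b ∧ y = a) := by
  obtain ⟨a, ha, b, hb, hab, hf⟩ := Finset.exists_ne_map_eq_of_card_lt_of_maps_to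
    (s := S) (t := S.image f) (by omega) (f := f) (fun x hx => Finset.mem_image_of_mem f hx)
  have key : ∀ a ∈ S, ∀ b ∈ S, a ≠ b → f a = f b → Set.InjOn f (S.erase a : Finset α) := by
    intro a ha b hb hab hf
    rw [← Finset.card_image_iff]
    have : (S.erase a).image f = S.image f := by
      ext z
      simp only [Finset.mem_image, Finset.mem_erase]
      constructor
      · rintro ⟨x, ⟨_, hx⟩, rfl⟩; exact ⟨x, hx, rfl⟩
      · rintro ⟨x, hx, rfl⟩
        by_cases hxa : x = a
        · exact ⟨b, ⟨hab.symm, hb⟩, by rw [hxa, hf]⟩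
        · exact ⟨x, ⟨hxa, hx⟩, rfl⟩
    rw [this, Finset.card_erase_of_mem ha]; omega
  have k1 := key a ha b hb hab hf
  have k2 := key b hb a ha hab.symm hf.symm
  refine ⟨a, ha, b, hb, hab, hf, ?_⟩
  intro x hx y hy hxy hne
  have h1 : x = a ∨ y = a := by
    by_contra hcon
    push Not at hcon
    exact hne (k1 (by simp [hcon.1, hx]) (by simp [hcon.2, hy]) hxy)
  have h2 : x = b ∨ y = b := by
    by_contra hcon
    push Not at hcon
    exact hne (k2 (by simp [hcon.1, hx]) (by simp [hcon.2, hy]) hxy)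
  grind

/-- dominant sets -/
def Domi {X I : Type*} (r : I → X → ℕ) (S : Finset X) : Prop :=
  ∀ y, ∃ i, ∀ x ∈ S, r i y ≤ r i x

section scarf
variable {X I : Type*} [Fintype X] [DecidableEq X] [Fintype I] [DecidableEq I]

lemma door_two (r : I → X → ℕ) (hr : ∀ i, Function.Injective (r i)) (D : Finset X)
    (hD : Domi r D) (hcard : D.card + 1 = Fintype.card I) (hne : D.Nonempty)
    (hM : ∀ a, ∃ z, ∀ i, i ≠ a → ∃ t ∈ D, r i t < r i z) :
    ∃ y₁ y₂, y₁ ≠ y₂ ∧ y₁ ∉ D ∧ y₂ ∉ D ∧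
      ∀ y, y ∉ D → (Domi r (insert y D) ↔ y = y₁ ∨ y = y₂) := by
  have hmin : ∀ i, ∃ m ∈ D, ∀ s ∈ D, r i m ≤ r i s := fun i =>
    D.exists_min_image (r i) hne
  choose m hmD hm using hmin
  have himg : Finset.univ.image m = D := by
    ext s
    simp only [Finset.mem_image, Finset.mem_univ, true_and]
    constructor
    · rintro ⟨i, rfl⟩; exact hmD i
    · intro hs
      obtain ⟨i, hi⟩ := hD s
      exact ⟨i, hr i (le_antisymm (hm i s hs) (hi _ (hmD i)))⟩
  obtain ⟨a, -, b, -, hab, hmab, huniq⟩ := collide m Finset.univ (by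
    rw [himg, Finset.card_univ]; omega)
  have hmax : ∀ a, ∃ y, (∀ i, i ≠ a → r i (m i) < r i y) ∧
      ∀ z, (∀ i, i ≠ a → r i (m i) < r i z) → r a z ≤ r a y := by
    intro a
    obtain ⟨z, hz⟩ := hM a
    obtain ⟨y, hy, hy'⟩ := (Finset.univ.filter
      (fun y => ∀ i, i ≠ a → r i (m i) < r i y)).exists_max_image (r a) ⟨z, by
        simp only [Finset.mem_filter, Finset.mem_univ, true_and]
        intro i hi
        obtain ⟨t, ht, h⟩ := hz i hi
        exact (hm i t ht).trans_lt h⟩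
    simp only [Finset.mem_filter, Finset.mem_univ, true_and] at hy hy'
    exact ⟨y, hy, hy'⟩
  choose Y hY hYmax using hmax
  have main : ∀ a b, a ≠ b → m a = m b → Y a ∉ D ∧ r a (Y a) ≤ r a (m a) ∧
      Domi r (insert (Y a) D) := by
    intro a b hab hmab
    have h1 : Y a ∉ D := by
      intro h
      rw [← himg] at h
      obtain ⟨j, -, hj⟩ := Finset.mem_image.1 h
      by_cases hja : j = a
      · have := hY a b hab.symm
        rw [← hj, hja, hmab] at this
        exact lt_irrefl _ this
      · have := hY a j hja
        rw [← hj] at this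
        exact lt_irrefl _ this
    have h2 : ∀ s ∈ D, r a (Y a) ≤ r a s := by
      obtain ⟨i, hi⟩ := hD (Y a)
      by_cases hia : i = a
      · rw [← hia] at hi ⊢; exact hi
      · exact absurd (hi _ (hmD i)) (not_le.2 (hY a i hia))
    refine ⟨h1, h2 _ (hmD a), ?_⟩
    intro z
    by_cases hz : ∀ i, i ≠ a → r i (m i) < r i z
    · refine ⟨a, fun x hx => ?_⟩
      rcases Finset.mem_insert.1 hx with rfl | hx
      · exact hYmax a z hz
      · exact (hYmax a z hz).trans (h2 x hx)
    · push Not at hz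
      obtain ⟨i, hia, hi⟩ := hz
      refine ⟨i, fun x hx => ?_⟩
      rcases Finset.mem_insert.1 hx with rfl | hx
      · exact hi.trans (hY a i hia).le
      · exact hi.trans (hm i x hx)
  obtain ⟨a1, a2, a3⟩ := main a b hab hmab
  obtain ⟨b1, b2, b3⟩ := main b a hab.symm hmab.symm
  refine ⟨Y a, Y b, ?_, a1, b1, ?_⟩
  · intro h
    have := hY b a hab
    rw [← h] at this
    omega
  intro y hy
  constructor
  swap
  · rintro (rfl | rfl) <;> assumption
  intro hdom
  obtain ⟨i, hi⟩ := hdom y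
  have hlt : r i y < r i (m i) := lt_of_le_of_ne (hi _ (Finset.mem_insert_of_mem (hmD i)))
    (fun h => hy (by rw [hr i h]; exact hmD i))
  have hsur : ∀ s ∈ D, ∃ j, m j = s ∧ r j (m j) < r j y := by
    intro s hs
    obtain ⟨j, hj⟩ := hdom s
    have : m j = s := hr j (le_antisymm (hm j s hs) (hj _ (Finset.mem_insert_of_mem (hmD j))))
    refine ⟨j, this, lt_of_le_of_ne (by rw [this]; exact hj _ (Finset.mem_insert_self _ _)) ?_⟩
    intro h
    exact hy (by rw [← hr j h]; exact hmD j)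
  -- i ∈ {a,b}
  have hiab : i = a ∨ i = b := by
    obtain ⟨j, hj, hj'⟩ := hsur (m i) (hmD i)
    have : j ≠ i := by rintro rfl; omega
    rcases huniq j (Finset.mem_univ _) i (Finset.mem_univ _) hj this with h | h
    · exact Or.inr h.2
    · exact Or.inl h.2
  have hyM : ∀ j, j ≠ i → r j (m j) < r j y := by
    intro j hj
    obtain ⟨l, hl, hl'⟩ := hsur (m j) (hmD j)
    by_cases hlj : l = j
    · rwa [hlj] at hl'
    · have hli : l ≠ i := by rintro rfl; omega
      have := huniq l (Finset.mem_univ _) j (Finset.mem_univ _) hl hlj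
      grind
  have hYi : y = Y i := by
    apply hr i
    apply le_antisymm (hYmax i y hyM)
    obtain ⟨j, hj⟩ := hdom (Y i)
    by_cases hji : j = i
    · rw [← hji]; rw [← hji] at hj; exact hj _ (Finset.mem_insert_self _ _)
    · exact absurd (hj _ (Finset.mem_insert_of_mem (hmD j))) (not_le.2 (hY i j hji))
  rcases hiab with rfl | rfl
  · exact Or.inl hYi
  · exact Or.inr hYi

lemma superset_card_succ {D S : Finset X} (h : D ⊆ S) (hc : S.card = D.card + 1) :
    ∃ y, y ∉ D ∧ S = insert y D := by
  have : (S \ D).card = 1 := by rw [Finset.card_sdiff_of_subset h]; omega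
  obtain ⟨y, hy⟩ := Finset.card_eq_one.1 this
  have hy' : y ∈ S \ D := by rw [hy]; simp
  rw [Finset.mem_sdiff] at hy'
  refine ⟨y, hy'.2, ?_⟩
  rw [← Finset.sdiff_union_of_subset h, hy]
  rfl

theorem scarf (r : I → X → ℕ) (hr : ∀ i, Function.Injective (r i)) (e : I → X)
    (he : Function.Injective e) (hbot : ∀ i x, r i (e i) ≤ r i x)
    (htop : ∀ i j x, i ≠ j → (∀ l, x ≠ e l) → r i x < r i (e j))
    (c : X → I) (hc : ∀ i, c (e i) = i) (t₀ : X) (ht₀ : ∀ l, t₀ ≠ e l) (i₀ : I) :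
    ∃ S : Finset X, Domi r S ∧ ∀ i, ∃ s ∈ S, c s = i := by
  classical
  by_contra hcon
  push Not at hcon
  set n := Fintype.card I with hn
  let rooms : Finset (Finset X) := Finset.univ.filter (fun S => Domi r S ∧ S.card = n)
  let doors : Finset (Finset X) := Finset.univ.filter
    (fun D => Domi r D ∧ D.card + 1 = n ∧ D.image c = Finset.univ.erase i₀)
  have hdc := Finset.sum_card_bipartiteAbove_eq_sum_card_bipartiteBelow
    (s := rooms) (t := doors) (fun S D => D ⊆ S)
  have hnpos : 0 < n := Fintype.card_pos_iff.2 ⟨i₀⟩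
  have herase : (Finset.univ.erase i₀).card + 1 = n := by
    rw [Finset.card_erase_of_mem (Finset.mem_univ _), Finset.card_univ]; omega
  have hrooms : ∀ S ∈ rooms, Even (Finset.bipartiteAbove (fun S D => D ⊆ S) doors S).card := by
    intro S hS
    simp only [rooms, Finset.mem_filter, Finset.mem_univ, true_and] at hS
    obtain ⟨hSd, hSc⟩ := hS
    rcases (Finset.bipartiteAbove (fun S D => D ⊆ S) doors S).eq_empty_or_nonempty with h0 | h0
    · rw [h0]; simp
    obtain ⟨D, hD⟩ := h0
    simp only [Finset.bipartiteAbove, doors, Finset.mem_filter, Finset.mem_univ, true_and] at hD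
    obtain ⟨⟨hDd, hDc, hDi⟩, hDS⟩ := hD
    obtain ⟨i₁, hi₁⟩ := hcon S hSd
    have hSi : S.image c = Finset.univ.erase i₀ := by
      have h1 : Finset.univ.erase i₀ ⊆ S.image c := by
        rw [← hDi]; exact Finset.image_subset_image hDS
      have h2 : i₁ ∉ S.image c := by
        simp only [Finset.mem_image, not_exists, not_and]; exact hi₁
      have h3 : i₁ = i₀ := by
        by_contra hne
        exact h2 (h1 (by simp [hne]))
      subst h3
      apply subset_antisymm _ h1
      intro x hx
      simp only [Finset.mem_erase, Finset.mem_univ, and_true]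
      rintro rfl
      exact h2 hx
    obtain ⟨a, ha, b, hb, hab, hcab, huniq⟩ := collide c S (by rw [hSi, herase, hSc])
    have : Finset.bipartiteAbove (fun S D => D ⊆ S) doors S = {S.erase a, S.erase b} := by
      ext D'
      simp only [Finset.bipartiteAbove, doors, Finset.mem_filter, Finset.mem_univ, true_and,
        Finset.mem_insert, Finset.mem_singleton]
      constructor
      · rintro ⟨⟨hd, hcd, hci⟩, hs⟩
        obtain ⟨y, hy, hSy⟩ := superset_card_succ hs (by omega)
        have hD' : D' = S.erase y := by rw [hSy, Finset.erase_insert hy]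
        have hyS : y ∈ S := by rw [hSy]; exact Finset.mem_insert_self _ _
        have : c y ∈ D'.image c := by
          rw [hci, ← hSi]; exact Finset.mem_image_of_mem _ hyS
        obtain ⟨x, hx, hxy⟩ := Finset.mem_image.1 this
        have := huniq x (hs hx) y hyS hxy (by rintro rfl; exact hy hx)
        rcases this with h | h
        · right; rw [hD', h.2]
        · left; rw [hD', h.2]
      · have aux : ∀ a ∈ S, ∀ b ∈ S, a ≠ b → c a = c b → (Domi r (S.erase a) ∧
            (S.erase a).card + 1 = n ∧ (S.erase a).image c = Finset.univ.erase i₀) ∧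
            S.erase a ⊆ S := by
          intro a ha b hb hab hcab
          refine ⟨⟨?_, ?_, ?_⟩, Finset.erase_subset _ _⟩
          · intro y
            obtain ⟨i, hi⟩ := hSd y
            exact ⟨i, fun x hx => hi x (Finset.mem_of_mem_erase hx)⟩
          · rw [Finset.card_erase_of_mem ha]; omega
          · rw [← hSi]
            ext z
            simp only [Finset.mem_image, Finset.mem_erase]
            constructor
            · rintro ⟨x, ⟨_, hx⟩, rfl⟩; exact ⟨x, hx, rfl⟩
            · rintro ⟨x, hx, rfl⟩
              by_cases hxa : x = a
              · exact ⟨b, ⟨hab.symm, hb⟩, by rw [hxa, hcab]⟩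
              · exact ⟨x, ⟨hxa, hx⟩, rfl⟩
        rintro (rfl | rfl)
        · exact aux a ha b hb hab hcab
        · exact aux b hb a ha hab.symm hcab.symm
    rw [this, Finset.card_pair]
    · exact even_two
    · intro h
      have : b ∈ S.erase a := by simp [hab.symm, hb]
      rw [h] at this
      simp at this
  -- the outside door
  let D₀ : Finset X := (Finset.univ.erase i₀).image e
  have memD₀ : ∀ x, x ∈ D₀ ↔ ∃ j, j ≠ i₀ ∧ e j = x := by
    intro x; simp [D₀]
  have hD₀c : D₀.card + 1 = n := by
    rw [Finset.card_image_of_injective _ he, herase]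
  have hD₀ : D₀ ∈ doors := by
    simp only [doors, Finset.mem_filter, Finset.mem_univ, true_and]
    refine ⟨?_, hD₀c, ?_⟩
    · intro y
      by_cases hy : ∃ l, y = e l
      · obtain ⟨l, rfl⟩ := hy
        exact ⟨l, fun x _ => hbot l x⟩
      · push Not at hy
        refine ⟨i₀, fun x hx => ?_⟩
        obtain ⟨j, hj, rfl⟩ := (memD₀ x).1 hx
        exact (htop i₀ j y hj.symm hy).le
    · rw [Finset.image_image]
      have : c ∘ e = id := funext hc
      rw [this, Finset.image_id]
  have hdoor0 : (Finset.bipartiteBelow (fun S D => D ⊆ S) rooms D₀).card = 1 := by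
    obtain ⟨t, ht, htmax⟩ := (Finset.univ.filter (fun x : X => ∀ l, x ≠ e l)).exists_max_image
      (r i₀) ⟨t₀, by simpa using ht₀⟩
    simp only [Finset.mem_filter, Finset.mem_univ, true_and] at ht htmax
    have htD : t ∉ D₀ := by
      rw [memD₀]; rintro ⟨j, -, hj⟩; exact ht j hj.symm
    rw [Finset.card_eq_one]
    refine ⟨insert t D₀, ?_⟩
    ext S
    simp only [Finset.bipartiteBelow, rooms, Finset.mem_filter, Finset.mem_univ, true_and,
      Finset.mem_singleton]
    constructor
    · rintro ⟨⟨hSd, hSc⟩, hs⟩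
      obtain ⟨y, hy, rfl⟩ := superset_card_succ hs (by omega)
      have hyT : ∀ l, y ≠ e l := by
        rintro l rfl
        have hl : l = i₀ := by
          by_contra hl
          exact hy ((memD₀ _).2 ⟨l, hl, rfl⟩)
        subst hl
        obtain ⟨i, hi⟩ := hSd t
        have : e i ∈ insert (e l) D₀ := by
          by_cases hil : i = l
          · rw [hil]; exact Finset.mem_insert_self _ _
          · exact Finset.mem_insert_of_mem ((memD₀ _).2 ⟨i, hil, rfl⟩)
        exact ht i (hr i (le_antisymm (hi _ this) (hbot i t)))
      obtain ⟨i, hi⟩ := hSd t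
      have hii : i = i₀ := by
        by_contra hii
        have := hi (e i) (Finset.mem_insert_of_mem ((memD₀ _).2 ⟨i, hii, rfl⟩))
        exact ht i (hr i (le_antisymm this (hbot i t)))
      subst hii
      have : y = t := hr i (le_antisymm (htmax y hyT) (hi y (Finset.mem_insert_self _ _)))
      rw [this]
    · rintro rfl
      refine ⟨⟨?_, ?_⟩, Finset.subset_insert _ _⟩
      · intro y
        by_cases hy : ∃ l, y = e l
        · obtain ⟨l, rfl⟩ := hy
          exact ⟨l, fun x _ => hbot l x⟩
        · push Not at hy
          refine ⟨i₀, fun x hx => ?_⟩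
          rcases Finset.mem_insert.1 hx with rfl | hx
          · exact htmax y hy
          · obtain ⟨j, hj, rfl⟩ := (memD₀ x).1 hx
            exact (htop i₀ j y hj.symm hy).le
      · rw [Finset.card_insert_of_notMem htD, hD₀c]
  have hdoors : ∀ D ∈ doors.erase D₀,
      (Finset.bipartiteBelow (fun S D => D ⊆ S) rooms D).card = 2 := by
    intro D hD
    obtain ⟨hDne, hD⟩ := Finset.mem_erase.1 hD
    simp only [doors, Finset.mem_filter, Finset.mem_univ, true_and] at hD
    obtain ⟨hDd, hDc, hDi⟩ := hD
    have hT : ∃ t ∈ D, ∀ l, t ≠ e l := by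
      by_contra hno
      push Not at hno
      apply hDne
      apply Finset.eq_of_subset_of_card_le
      · intro x hx
        obtain ⟨l, rfl⟩ := hno x hx
        rw [memD₀]
        refine ⟨l, ?_, rfl⟩
        have : c (e l) ∈ D.image c := Finset.mem_image_of_mem _ hx
        rw [hDi, hc] at this
        exact (Finset.mem_erase.1 this).1
      · omega
    obtain ⟨t, htD, ht⟩ := hT
    obtain ⟨y₁, y₂, hy, h1, h2, hiff⟩ := door_two r hr D hDd hDc ⟨t, htD⟩
      (fun a => ⟨e a, fun i hi => ⟨t, htD, htop i a t hi ht⟩⟩)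
    have : Finset.bipartiteBelow (fun S D => D ⊆ S) rooms D = {insert y₁ D, insert y₂ D} := by
      ext S
      simp only [Finset.bipartiteBelow, rooms, Finset.mem_filter, Finset.mem_univ, true_and,
        Finset.mem_singleton, Finset.mem_insert]
      constructor
      · rintro ⟨⟨hSd, hSc⟩, hs⟩
        obtain ⟨y, hy, rfl⟩ := superset_card_succ hs (by omega)
        rcases (hiff y hy).1 hSd with rfl | rfl
        · exact Or.inl rfl
        · exact Or.inr rfl
      · rintro (rfl | rfl)
        · exact ⟨⟨(hiff y₁ h1).2 (Or.inl rfl), by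
            rw [Finset.card_insert_of_notMem h1, hDc]⟩, Finset.subset_insert _ _⟩
        · exact ⟨⟨(hiff y₂ h2).2 (Or.inr rfl), by
            rw [Finset.card_insert_of_notMem h2, hDc]⟩, Finset.subset_insert _ _⟩
    rw [this, Finset.card_pair]
    intro h
    have : y₁ ∈ insert y₂ D := by rw [← h]; exact Finset.mem_insert_self _ _
    rcases Finset.mem_insert.1 this with h | h
    · exact hy h
    · exact h1 h
  have hev := Finset.even_sum _ hrooms
  rw [hdc, ← Finset.add_sum_erase _ _ hD₀, hdoor0, Finset.sum_congr rfl hdoors] at hev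
  simp only [Finset.sum_const, smul_eq_mul] at hev
  rw [Nat.even_iff] at hev
  omega

end scarf

theorem discrete_brouwer {I : Type*} [Fintype I] [DecidableEq I] (i₀ : I) (N : ℕ)
    (c : (I → ℕ) → I) :
    ∃ p : I → ℕ, ∑ j, p j = N ∧ ∀ i, (∃ x : I → ℕ, ∑ j, x j = N ∧ c x = i ∧
      ∀ j, x j ≤ p j + Fintype.card I ∧ p j ≤ x j + Fintype.card I) ∨ p i ≤ Fintype.card I := by
  classical
  let F : Finset (I → ℕ) := Finset.piAntidiag Finset.univ N
  have memF : ∀ x, x ∈ F ↔ ∑ j, x j = N := by intro x; simp [F]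
  let T := {x // x ∈ F}
  let K := Fintype.card T
  let idx : T ≃ Fin K := Fintype.equivFin T
  let idI : I ≃ Fin (Fintype.card I) := Fintype.equivFin I
  have hTN : ∀ (t : T) i, t.1 i ≤ N := by
    intro t i
    have := (memF t.1).1 t.2
    rw [← this]
    exact Finset.single_le_sum (f := t.1) (fun _ _ => Nat.zero_le _) (Finset.mem_univ i)
  let r : I → T ⊕ I → ℕ := fun i => Sum.elim (fun t => t.1 i * K + (idx t : ℕ) + 1)
    (fun j => if j = i then 0 else (N + 1) * K + 1 + (idI j : ℕ))
  have r1 : ∀ i t, r i (Sum.inl t) = t.1 i * K + (idx t : ℕ) + 1 := fun _ _ => rfl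
  have r2 : ∀ i, r i (Sum.inr i) = 0 := fun i => by simp [r]
  have r3 : ∀ i j, j ≠ i → r i (Sum.inr j) = (N + 1) * K + 1 + (idI j : ℕ) :=
    fun i j h => by simp [r, h]
  have hlt : ∀ i (s t : T), s.1 i < t.1 i → r i (Sum.inl s) < r i (Sum.inl t) := by
    intro i s t h
    rw [r1, r1]
    have h1 : (s.1 i + 1) * K ≤ t.1 i * K := Nat.mul_le_mul_right _ h
    have h2 := (idx s).2
    rw [add_mul, one_mul] at h1
    omega
  have hbd : ∀ i (s : T), r i (Sum.inl s) < (N + 1) * K + 1 := by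
    intro i s
    rw [r1]
    have h1 : s.1 i * K ≤ N * K := Nat.mul_le_mul_right _ (hTN s i)
    have h2 := (idx s).2
    rw [add_mul, one_mul]
    omega
  have hinj : ∀ i, Function.Injective (r i) := by
    intro i x y hxy
    rcases x with x | x <;> rcases y with y | y
    · rcases lt_trichotomy (x.1 i) (y.1 i) with h | h | h
      · have := hlt i x y h; omega
      · rw [r1, r1, h] at hxy
        have : idx x = idx y := Fin.ext (by omega)
        rw [idx.injective this]
      · have := hlt i y x h; omega
    · by_cases hy : y = i
      · rw [hy, r1, r2] at hxy; omega
      · have := hbd i x; rw [r3 i y hy] at hxy; omega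
    · by_cases hy : x = i
      · rw [hy, r1, r2] at hxy; omega
      · have := hbd i y; rw [r3 i x hy] at hxy; omega
    · by_cases hx : x = i <;> by_cases hy : y = i
      · rw [hx, hy]
      · rw [hx, r2, r3 i y hy] at hxy; omega
      · rw [hy, r2, r3 i x hx] at hxy; omega
      · rw [r3 i x hx, r3 i y hy] at hxy
        have : idI x = idI y := Fin.ext (by omega)
        rw [idI.injective this]
  let t₀ : T := ⟨Pi.single i₀ N, by rw [memF]; simp⟩
  obtain ⟨S, hdom, hcol⟩ := scarf r hinj Sum.inr Sum.inr_injective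
    (fun i x => by rw [r2]; exact Nat.zero_le _)
    (by
      intro i j x hij hx
      rcases x with x | x
      · have := hbd i x
        rw [r3 i j hij.symm]; omega
      · exact absurd rfl (hx x))
    (Sum.elim (fun t => c t.1) id) (fun i => rfl) (Sum.inl t₀) (fun l => Sum.inl_ne_inr) i₀
  obtain ⟨p, hp⟩ : ∃ p : T, Sum.inl p ∈ S := by
    obtain ⟨i, hi⟩ := hdom (Sum.inl t₀)
    obtain ⟨s, hs, hsi⟩ := hcol i
    rcases s with s | s
    · exact ⟨s, hs⟩
    · have h : s = i := hsi
      have := hi _ hs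
      rw [h, r1, r2] at this
      omega
  have hmin : ∀ i, ∃ s ∈ S, ∀ x ∈ S, r i s ≤ r i x := fun i => S.exists_min_image (r i) ⟨_, hp⟩
  choose s hsS hs using hmin
  let m : I → ℕ := fun i => Sum.elim (fun t : T => t.1 i) (fun _ => 0) (s i)
  have hm1 : ∀ t : T, Sum.inl t ∈ S → ∀ i, m i ≤ t.1 i := by
    intro t ht i
    have h := hs i _ ht
    rcases h' : s i with t' | j
    · have : m i = t'.1 i := by simp [m, h']
      rw [this]
      by_contra hcon
      have := hlt i t t' (by omega)
      rw [h'] at h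
      omega
    · have : m i = 0 := by simp [m, h']
      omega
  have hm2 : N < ∑ i, m i + Fintype.card I := by
    by_contra hcon
    push Not at hcon
    let y : I → ℕ := fun i => m i + 1 + (Pi.single i₀ (N - (∑ i, m i + Fintype.card I)) : I → ℕ) i
    have hy : ∑ i, y i = N := by
      simp only [y, Finset.sum_add_distrib, Finset.sum_pi_single', Finset.sum_const,
        Finset.card_univ, smul_eq_mul, Finset.mem_univ]
      rw [if_pos trivial]; omega
    obtain ⟨i, hi⟩ := hdom (Sum.inl ⟨y, (memF y).2 hy⟩)
    have h1 := hi _ (hsS i)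
    rcases h' : s i with t' | j
    · have hm : m i = t'.1 i := by simp [m, h']
      have := hlt i t' ⟨y, (memF y).2 hy⟩ (by rw [← hm]; simp only [y]; omega)
      rw [h'] at h1; omega
    · have h2 := hs i _ hp
      rw [h'] at h1 h2
      by_cases hj : j = i
      · rw [hj, r2, r1] at h1; omega
      · rw [r3 i j hj] at h2
        have := hbd i p
        omega
  have hm3 : ∀ t : T, Sum.inl t ∈ S → ∀ i, t.1 i ≤ m i + Fintype.card I := by
    intro t ht i
    have h1 := (memF t.1).1 t.2
    have h2 := hm1 t ht
    have h3 : ∑ j ∈ Finset.univ.erase i, m j ≤ ∑ j ∈ Finset.univ.erase i, t.1 j :=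
      Finset.sum_le_sum (fun j _ => h2 j)
    rw [← Finset.add_sum_erase _ _ (Finset.mem_univ i)] at h1 hm2
    omega
  refine ⟨p.1, (memF _).1 p.2, fun i => ?_⟩
  obtain ⟨x, hx, hxi⟩ := hcol i
  rcases x with x | x
  · left
    refine ⟨x.1, (memF _).1 x.2, hxi, fun j => ?_⟩
    have a1 := hm1 x hx j
    have a2 := hm1 p hp j
    have a3 := hm3 x hx j
    have a4 := hm3 p hp j
    omega
  · right
    have hxi' : x = i := hxi
    subst hxi'
    have h1 := hs x _ hx
    rw [r2] at h1
    have : m x = 0 := by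
      rcases h' : s x with t' | j
      · rw [h', r1] at h1; omega
      · simp [m, h']
    have := hm3 p hp x
    omega

open Filter Topology in
theorem brouwer_simplex {I : Type*} [Fintype I] [Nonempty I] (f : (I → ℝ) → (I → ℝ))
    (hf : ContinuousOn f (stdSimplex ℝ I)) (hmaps : Set.MapsTo f (stdSimplex ℝ I) (stdSimplex ℝ I)) :
    ∃ x ∈ stdSimplex ℝ I, f x = x := by
  classical
  obtain ⟨i₀⟩ := ‹Nonempty I›
  have hcol : ∀ x ∈ stdSimplex ℝ I, ∃ i, x i ≤ f x i := by
    intro x hx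
    by_contra hcon
    push Not at hcon
    have := Finset.sum_lt_sum_of_nonempty (s := Finset.univ) ⟨i₀, Finset.mem_univ _⟩
      (fun i _ => hcon i)
    rw [hx.2, (hmaps hx).2] at this
    exact lt_irrefl _ this
  set n := Fintype.card I
  have step : ∀ k : ℕ, ∃ p ∈ stdSimplex ℝ I, ∀ i, ∃ x ∈ stdSimplex ℝ I,
      (∀ j, |x j - p j| ≤ n / ((k : ℝ) + 1)) ∧ x i - n / ((k : ℝ) + 1) ≤ f x i := by
    intro k
    have hk : (0 : ℝ) < (k : ℝ) + 1 := by positivity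
    let sc : (I → ℕ) → (I → ℝ) := fun x j => (x j : ℝ) / ((k : ℝ) + 1)
    have hsc : ∀ x : I → ℕ, ∑ j, x j = k + 1 → sc x ∈ stdSimplex ℝ I := by
      intro x hx
      refine ⟨fun j => by simp only [sc]; positivity, ?_⟩
      simp only [sc]
      rw [← Finset.sum_div, ← Nat.cast_sum, hx]
      push_cast
      exact div_self hk.ne'
    have hc : ∀ x : I → ℕ, ∃ i, ∑ j, x j = k + 1 → sc x i ≤ f (sc x) i := by
      intro x
      by_cases hx : ∑ j, x j = k + 1
      · obtain ⟨i, hi⟩ := hcol _ (hsc x hx)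
        exact ⟨i, fun _ => hi⟩
      · exact ⟨i₀, fun h => absurd h hx⟩
    choose c hc using hc
    obtain ⟨p, hp, h⟩ := discrete_brouwer i₀ (k + 1) c
    refine ⟨sc p, hsc p hp, fun i => ?_⟩
    have hpos : 0 ≤ n / ((k : ℝ) + 1) := by positivity
    rcases h i with ⟨x, hx, hxi, hxp⟩ | h
    · refine ⟨sc x, hsc x hx, fun j => ?_, ?_⟩
      · simp only [sc]
        rw [← sub_div, abs_div, abs_of_pos hk]
        apply div_le_div_of_nonneg_right _ hk.le
        rw [abs_le]
        have h1 : (x j : ℝ) ≤ p j + n := by exact_mod_cast (hxp j).1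
        have h2 : (p j : ℝ) ≤ x j + n := by exact_mod_cast (hxp j).2
        constructor <;> linarith
      · have := hc x hx
        rw [hxi] at this
        linarith
    · refine ⟨sc p, hsc p hp, fun j => by simpa using hpos, ?_⟩
      have h1 : sc p i ≤ n / ((k : ℝ) + 1) := by
        simp only [sc]
        apply div_le_div_of_nonneg_right _ hk.le
        exact_mod_cast h
      have := (hmaps (hsc p hp)).1 i
      linarith
  choose p hp x hx hxp hxf using step
  obtain ⟨q, hq, φ, hφ, hlim⟩ := (isCompact_stdSimplex ℝ I).tendsto_subseq hp
  have hz : Tendsto (fun k : ℕ => (n : ℝ) / ((φ k : ℝ) + 1)) atTop (𝓝 0) :=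
    Tendsto.comp (g := fun k : ℕ => (n : ℝ) / ((k : ℝ) + 1)) (by
      have := (tendsto_one_div_add_atTop_nhds_zero_nat (𝕜 := ℝ)).const_mul (n : ℝ)
      simpa [div_eq_mul_inv] using this) hφ.tendsto_atTop
  have hxq : ∀ i, Tendsto (fun k => x (φ k) i) atTop (𝓝 q) := by
    intro i
    rw [tendsto_pi_nhds]
    intro j
    have h1 : Tendsto (fun k => x (φ k) i j - p (φ k) j) atTop (𝓝 0) :=
      squeeze_zero_norm (fun k => hxp (φ k) i j) hz
    have h2 : Tendsto (fun k => p (φ k) j) atTop (𝓝 (q j)) := (tendsto_pi_nhds.1 hlim) j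
    simpa using h1.add h2
  have hle : ∀ i, q i ≤ f q i := by
    intro i
    have h1 : Tendsto (fun k => f (x (φ k) i)) atTop (𝓝 (f q)) :=
      (hf q hq).tendsto.comp (tendsto_nhdsWithin_iff.2
        ⟨hxq i, Eventually.of_forall (fun k => hx (φ k) i)⟩)
    have h2 := (tendsto_pi_nhds.1 h1) i
    have h3 := ((tendsto_pi_nhds.1 (hxq i)) i).sub hz
    rw [sub_zero] at h3
    exact le_of_tendsto_of_tendsto' h3 h2 (fun k => hxf (φ k) i)
  refine ⟨q, hq, ?_⟩
  have hsum : ∑ i, q i = ∑ i, f q i := by rw [hq.2, (hmaps hq).2]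
  have := (Finset.sum_eq_sum_iff_of_le (fun i _ => hle i)).1 hsum
  funext i
  exact (this i (Finset.mem_univ i)).symm

section nash
variable {ι : Type*} [Fintype ι] [DecidableEq ι] {E : ι → Type*}
  [∀ i, NormedAddCommGroup (E i)] [∀ i, NormedSpace ℝ (E i)]

theorem nash_finite (U : ∀ i, Set (E i)) (hconv : ∀ i, Convex ℝ (U i))
    (J : ι → (∀ i, E i) → ℝ) (hJ : ∀ i, ContinuousOn (J i) {u | ∀ j, u j ∈ U j})
    (hqc : ∀ i, ∀ u : ∀ i, E i, (∀ j, u j ∈ U j) → ∀ a : ℝ,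
      Convex ℝ {x | x ∈ U i ∧ a ≤ J i (Function.update u i x)})
    (F : ∀ i, Finset (E i)) (hF : ∀ i, (F i).Nonempty) (hFU : ∀ i, ∀ x ∈ F i, x ∈ U i)
    (ε : ℝ) (hε : 0 < ε) :
    ∃ u : ∀ i, E i, (∀ j, u j ∈ U j) ∧ ∀ i, ∀ v ∈ F i, J i (Function.update u i v) ≤ J i u + ε := by
  classical
  let P := ∀ i, {x // x ∈ F i}
  haveI : Nonempty P := ⟨fun i => ⟨_, (hF i).choose_spec⟩⟩
  let w : P → (∀ i, E i) → ℝ := fun p u => ∏ i, ∏ y ∈ F i,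
    max 0 (J i (Function.update u i (p i).1) - J i (Function.update u i y) + ε)
  have hw0 : ∀ p u, 0 ≤ w p u := fun p u =>
    Finset.prod_nonneg (fun i _ => Finset.prod_nonneg (fun y _ => le_max_left _ _))
  have hwpos : ∀ u, 0 < ∑ p, w p u := by
    intro u
    have hmax : ∀ i, ∃ x ∈ F i, ∀ y ∈ F i,
        J i (Function.update u i y) ≤ J i (Function.update u i x) := fun i =>
      (F i).exists_max_image (fun x => J i (Function.update u i x)) (hF i)
    choose x hx hxm using hmax
    apply Finset.sum_pos' (fun p _ => hw0 p u)
    refine ⟨fun i => ⟨x i, hx i⟩, Finset.mem_univ _, ?_⟩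
    apply Finset.prod_pos; intro i _
    apply Finset.prod_pos; intro y hy
    apply lt_max_of_lt_right
    have := hxm i y hy
    dsimp only
    linarith
  have hupd : ∀ i, ∀ y ∈ U i, ContinuousOn (fun u : ∀ i, E i => J i (Function.update u i y))
      {u | ∀ j, u j ∈ U j} := by
    intro i y hy
    refine (hJ i).comp (f := fun u : ∀ i, E i => Function.update u i y) ?_ ?_
    · exact (continuous_id.update i continuous_const).continuousOn
    · intro u hu j
      by_cases hj : j = i
      · subst hj; simpa using hy
      · simpa [hj] using hu j
  have hwc : ∀ p, ContinuousOn (w p) {u | ∀ j, u j ∈ U j} := by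
    intro p
    apply continuousOn_finsetProd; intro i _
    apply continuousOn_finsetProd; intro y hy
    exact ContinuousOn.sup continuousOn_const (((hupd i _ (hFU i _ (p i).2)).sub (hupd i y (hFU i y hy))).add
      continuousOn_const)
  let b : (P → ℝ) → (∀ i, E i) := fun c i => ∑ p, c p • (p i).1
  have hb : Continuous b := by
    apply continuous_pi; intro i
    exact continuous_finsetSum _ (fun p _ => (continuous_apply p).smul continuous_const)
  have hbU : ∀ c ∈ stdSimplex ℝ P, ∀ i, b c i ∈ U i := by
    intro c hc i
    exact (hconv i).sum_mem (fun p _ => hc.1 p) hc.2 (fun p _ => hFU i _ (p i).2)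
  let g : (P → ℝ) → (P → ℝ) := fun c p => w p (b c) / ∑ q, w q (b c)
  have hgmaps : Set.MapsTo g (stdSimplex ℝ P) (stdSimplex ℝ P) := by
    intro c _
    refine ⟨fun p => div_nonneg (hw0 _ _) (hwpos _).le, ?_⟩
    simp only [g]
    rw [← Finset.sum_div]
    exact div_self (hwpos _).ne'
  have hgc : ContinuousOn g (stdSimplex ℝ P) := by
    apply continuousOn_pi.2; intro p
    have hcomp : ∀ p, ContinuousOn (fun c => w p (b c)) (stdSimplex ℝ P) := fun p =>
      (hwc p).comp hb.continuousOn (fun c hc => hbU c hc)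
    exact (hcomp p).div (continuousOn_finsetSum _ (fun q _ => hcomp q)) (fun c _ => (hwpos _).ne')
  obtain ⟨c, hc, hfix⟩ := brouwer_simplex g hgc hgmaps
  refine ⟨b c, hbU c hc, fun i v hv => ?_⟩
  have hmem : b c i ∈ {x | x ∈ U i ∧
      J i (Function.update (b c) i v) - ε ≤ J i (Function.update (b c) i x)} := by
    have h1 : b c i = ∑ p ∈ Finset.univ.filter (fun p => c p ≠ 0), c p • (p i).1 := by
      symm
      apply Finset.sum_filter_of_ne
      intro p _ h h0
      exact h (by rw [h0, zero_smul])
    rw [h1]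
    apply (hqc i (b c) (hbU c hc) _).sum_mem (fun p _ => hc.1 p)
    · rw [Finset.sum_filter_ne_zero]; exact hc.2
    · intro p hp
      have hp := (Finset.mem_filter.1 hp).2
      refine ⟨hFU i _ (p i).2, ?_⟩
      have hwp : w p (b c) ≠ 0 := by
        intro h0
        apply hp
        rw [← hfix]
        simp only [g, h0, zero_div]
      have h2 := (Finset.prod_ne_zero_iff.1 ((Finset.prod_ne_zero_iff.1 hwp) i
        (Finset.mem_univ i))) v hv
      by_contra hcon
      push Not at hcon
      exact h2 (max_eq_left (by linarith))
  have := hmem.2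
  rw [Function.update_eq_self] at this
  linarith

theorem nash (U : ∀ i, Set (E i)) (hne : ∀ i, (U i).Nonempty) (hconv : ∀ i, Convex ℝ (U i))
    (hcomp : ∀ i, IsCompact (U i))
    (J : ι → (∀ i, E i) → ℝ) (hJ : ∀ i, ContinuousOn (J i) {u | ∀ j, u j ∈ U j})
    (hqc : ∀ i, ∀ u : ∀ i, E i, (∀ j, u j ∈ U j) → ∀ a : ℝ,
      Convex ℝ {x | x ∈ U i ∧ a ≤ J i (Function.update u i x)}) :
    ∃ u : ∀ i, E i, (∀ j, u j ∈ U j) ∧ ∀ i, ∀ v ∈ U i, J i (Function.update u i v) ≤ J i u := by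
  classical
  let X : Set (∀ i, E i) := {u | ∀ j, u j ∈ U j}
  have hX : IsCompact X := by
    have := isCompact_univ_pi hcomp
    convert this using 1
    ext u; simp [X]
  let Q := (Σ i, {v // v ∈ U i}) × {ε : ℝ // 0 < ε}
  let A : Q → Set (∀ i, E i) := fun q =>
    X ∩ {u | J q.1.1 (Function.update u q.1.1 q.1.2.1) - J q.1.1 u ≤ q.2.1}
  have hA : ∀ q, IsClosed (A q) := by
    rintro ⟨⟨i, v, hv⟩, ε, hε⟩
    have hupd : ContinuousOn (fun u : ∀ i, E i => J i (Function.update u i v)) X := by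
      refine (hJ i).comp (f := fun u : ∀ i, E i => Function.update u i v) ?_ ?_
      · exact (continuous_id.update i continuous_const).continuousOn
      · intro u hu j
        by_cases hj : j = i
        · subst hj; simpa using hv
        · simpa [hj] using hu j
    exact (hupd.sub (hJ i)).preimage_isClosed_of_isClosed hX.isClosed isClosed_Iic
  have hfin : ∀ s : Finset Q, (X ∩ ⋂ q ∈ s, A q).Nonempty := by
    intro s
    haveI : Nonempty {ε : ℝ // 0 < ε} := ⟨⟨1, one_pos⟩⟩
    obtain ⟨ε, hε⟩ : ∃ ε : ℝ, 0 < ε ∧ ∀ q ∈ s, ε ≤ q.2.1 := by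
      induction s using Finset.induction_on with
      | empty => exact ⟨1, one_pos, by simp⟩
      | insert a s _ ih =>
        obtain ⟨ε, h0, h⟩ := ih
        refine ⟨min ε a.2.1, lt_min h0 a.2.2, ?_⟩
        intro q hq
        rcases Finset.mem_insert.1 hq with rfl | hq
        · exact min_le_right _ _
        · exact (min_le_left _ _).trans (h q hq)
    let F : ∀ i, Finset (E i) := fun i => insert (hne i).some
      ((s.filter (fun q => q.1.1 = i)).image
        (fun q => if h : q.1.1 = i then h ▸ q.1.2.1 else (hne i).some))
    obtain ⟨u, hu, hu'⟩ := nash_finite U hconv J hJ hqc F (fun i => ⟨_, Finset.mem_insert_self _ _⟩)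
      (by
        intro i x hx
        rcases Finset.mem_insert.1 hx with rfl | hx
        · exact (hne i).some_mem
        · obtain ⟨q, hq, rfl⟩ := Finset.mem_image.1 hx
          have h := (Finset.mem_filter.1 hq).2
          subst h
          simpa using q.1.2.2) ε hε.1
    refine ⟨u, hu, ?_⟩
    simp only [Set.mem_iInter]
    intro q hq
    refine ⟨hu, ?_⟩
    have := hu' q.1.1 q.1.2.1 (Finset.mem_insert_of_mem (Finset.mem_image.2
      ⟨q, Finset.mem_filter.2 ⟨hq, rfl⟩, by simp⟩))
    have h2 := hε.2 q hq
    simp only [Set.mem_ofPred_eq]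
    linarith
  obtain ⟨u, hu, hu'⟩ := hX.inter_iInter_nonempty A hA hfin
  refine ⟨u, hu, fun i v hv => ?_⟩
  apply le_of_forall_pos_le_add
  intro ε hε
  have := (Set.mem_iInter.1 hu' (⟨i, v, hv⟩, ⟨ε, hε⟩)).2
  simp only [Set.mem_ofPred_eq] at this
  linarith

end nash

/-- Theorem 3.2 of the paper: existence of open-loop Pareto-Nash
equilibria in multi-objective interval differential games.
Each player `i ∈ Fin n` has a strategy set `U i`, a nonempty convex compact subset of the
Banach space `C([t₀,t₁], ℝ^{m i})` (continuous maps with the sup norm), and an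
interval-vector-valued payoff with endpoint functions `Jl i k, Ju i k` (`Jl ≤ Ju`).
If for each `i` there is a component `k i` whose interval payoff is continuous on the
product of the strategy sets and, in each own strategy, generalized
`I(ℝ₊)`-quasi-concave, then an open-loop Pareto-Nash equilibrium exists: a profile `u*`
with each `u* i ∈ U i` such that no unilateral deviation strictly dominates `Jᵢ(u*)`
from below, i.e. for every deviation some component `k` satisfies
`Jl i k (deviation) ≤ Jl i k u*` or `Ju i k (deviation) ≤ Ju i k u*`. -/
theorem stmt_1 (n : ℕ) (t₀ t₁ : ℝ) (ht : t₀ < t₁) (m d : Fin n → ℕ)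
    (U : ∀ i : Fin n, Set C(Set.Icc t₀ t₁, EuclideanSpace ℝ (Fin (m i))))
    (hUne : ∀ i, (U i).Nonempty)
    (hUconv : ∀ i, Convex ℝ (U i))
    (hUcomp : ∀ i, IsCompact (U i))
    (Jl Ju : ∀ i : Fin n, Fin (d i) →
      (∀ j : Fin n, C(Set.Icc t₀ t₁, EuclideanSpace ℝ (Fin (m j)))) → ℝ)
    (hJle : ∀ i k u, Jl i k u ≤ Ju i k u)
    (k : ∀ i : Fin n, Fin (d i))
    (hJlcont : ∀ i, ContinuousOn (Jl i (k i)) {u | ∀ j, u j ∈ U j})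
    (hJucont : ∀ i, ContinuousOn (Ju i (k i)) {u | ∀ j, u j ∈ U j})
    (hqc : ∀ i : Fin n,
      ∀ u : (∀ j : Fin n, C(Set.Icc t₀ t₁, EuclideanSpace ℝ (Fin (m j)))),
      (∀ j, u j ∈ U j) →
      ∀ x₁ ∈ U i, ∀ x₂ ∈ U i, ∀ al au : ℝ, al ≤ au →
      ∀ lam : ℝ, lam ∈ Set.Icc (0 : ℝ) 1 →
      (al ≤ Jl i (k i) (Function.update u i x₁) ∨ au ≤ Ju i (k i) (Function.update u i x₁)) →
      (al ≤ Jl i (k i) (Function.update u i x₂) ∨ au ≤ Ju i (k i) (Function.update u i x₂)) →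
      (al ≤ Jl i (k i) (Function.update u i (lam • x₁ + (1 - lam) • x₂)) ∨
        au ≤ Ju i (k i) (Function.update u i (lam • x₁ + (1 - lam) • x₂)))) :
    ∃ ustar : ∀ j : Fin n, C(Set.Icc t₀ t₁, EuclideanSpace ℝ (Fin (m j))),
      (∀ j, ustar j ∈ U j) ∧
      ∀ i : Fin n, ∀ v ∈ U i, ∃ kk : Fin (d i),
        Jl i kk (Function.update ustar i v) ≤ Jl i kk ustar ∨
        Ju i kk (Function.update ustar i v) ≤ Ju i kk ustar := by
  obtain ⟨u, hu, h⟩ := nash U hUne hUconv hUcomp (fun i => Jl i (k i)) hJlcont (by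
    intro i u hu a x₁ hx₁ x₂ hx₂ s t hs ht' hst
    have htt : t = 1 - s := by linarith
    subst htt
    have hmem := hUconv i hx₁.1 hx₂.1 hs ht' hst
    refine ⟨hmem, ?_⟩
    -- choose the upper level above every relevant value, so only the lower endpoint matters
    have hq := hqc i u hu x₁ hx₁.1 x₂ hx₂.1 a
      (max a (Ju i (k i) (Function.update u i (s • x₁ + (1 - s) • x₂)) + 1)) (le_max_left _ _)
      s ⟨hs, by linarith⟩ (Or.inl hx₁.2) (Or.inl hx₂.2)
    rcases hq with hq | hq
    · exact hq
    · have := (le_max_right _ _).trans hq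
      linarith)
  exact ⟨u, hu, fun i v hv => ⟨k i, Or.inl (h i v hv)⟩⟩
end

section
/- Consider an n-player multi-objective interval game in which, for each player i, the strategy set Uᵢ is a nonempty, convex, compact subset of C([t₀,t₁]; ℝ^{mᵢ}) with the supremum norm, and player i's payoff is Jᵢ = (Jᵢ₁, …, J_{i,dᵢ}) : U₁ × ⋯ × Uₙ → I(ℝ)^{dᵢ} with Jᵢₖ = [J̲ᵢₖ, J̄ᵢₖ]. Fix for each player i a weight vector ωᵢ = (ω₁ⁱ, …, ω_{dᵢ}ⁱ) with all ωₖⁱ > 0, and define the weighted interval payoff ⟨ωᵢ, Jᵢ⟩ = Σₖ ωₖⁱ Jₖⁱ, the interval with endpoints Σₖ ωₖⁱ J̲ᵢₖ and Σₖ ωₖⁱ J̄ᵢₖ. Suppose for each i: (i) ⟨ωᵢ, Jᵢ⟩ is continuous (both endpoint functions are continuous); (ii) for each fixed u₋ᵢ, the map uᵢ ↦ ⟨ωᵢ, Jᵢ(uᵢ, u₋ᵢ)⟩ is generalized I(ℝ₊)-quasi-concave on Uᵢ. Then there exists a weighted open-loop Pareto-Nash equilibrium u*: for every i and every uᵢ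 ∈ Uᵢ, Σₖ ωₖⁱ J̲ᵢₖ(uᵢ, u*₋ᵢ) ≤ Σₖ ωₖⁱ J̲ᵢₖ(u*) or Σₖ ωₖⁱ J̄ᵢₖ(uᵢ, u*₋ᵢ) ≤ Σₖ ωₖⁱ J̄ᵢₖ(u*). -/
/-! Scarf-type combinatorial lemma -/

/-- dominance -/
def ScDom {I V : Type} (r : I → V → ℕ) (S : Finset V) : Prop :=
  ∀ y : V, ∃ i, ∀ x ∈ S, r i y ≤ r i x

/-- In a set with as many elements as colours which is not rainbow, the number of facets of type
`i0` is even. -/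
lemma sc_room {I V : Type} [Fintype I] [DecidableEq I] [DecidableEq V] (c : V → I) (i0 : I)
    (S : Finset V) (hS : S.card = Fintype.card I) (hnr : S.image c ≠ Finset.univ) :
    Even ((S.filter (fun x => (S.erase x).image c = Finset.univ.erase i0)).card) := by
  classical
  rcases Finset.eq_empty_or_nonempty
    (S.filter (fun x => (S.erase x).image c = Finset.univ.erase i0)) with h | ⟨x, hx⟩
  · rw [h]; simp
  rw [Finset.mem_filter] at hx
  obtain ⟨hxS, hx⟩ := hx
  have hcx : c x ≠ i0 := by
    intro h
    apply hnr
    rw [← Finset.insert_erase hxS, Finset.image_insert, hx, h]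
    simp
  have hmem : c x ∈ (S.erase x).image c := by rw [hx]; simp [hcx]
  obtain ⟨x', hx', hcx'⟩ := Finset.mem_image.1 hmem
  have hinj : Set.InjOn c (S.erase x : Finset V) := by
    apply Finset.injOn_of_card_image_eq
    rw [hx, Finset.card_erase_of_mem hxS, Finset.card_erase_of_mem (Finset.mem_univ _), hS,
      Finset.card_univ]
  have hne : x' ≠ x := (Finset.mem_erase.1 hx').1
  have hx'S : x' ∈ S := (Finset.mem_erase.1 hx').2
  have : S.filter (fun x => (S.erase x).image c = Finset.univ.erase i0) = {x, x'} := by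
    ext z
    simp only [Finset.mem_filter, Finset.mem_insert, Finset.mem_singleton]
    constructor
    · rintro ⟨hz, hzi⟩
      by_contra hcon
      push Not at hcon
      have hinj2 : Set.InjOn c (S.erase z : Finset V) := by
        apply Finset.injOn_of_card_image_eq
        rw [hzi, Finset.card_erase_of_mem hz, Finset.card_erase_of_mem (Finset.mem_univ _), hS,
          Finset.card_univ]
      apply hne
      apply hinj2
      · simp [hx'S, Ne.symm hcon.2]
      · simp [hxS, Ne.symm hcon.1]
      · exact hcx'
    · rintro (rfl | rfl)
      · exact ⟨hxS, hx⟩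
      · refine ⟨hx'S, ?_⟩
        rw [← hx]
        ext i
        simp only [Finset.mem_image, Finset.mem_erase]
        constructor
        · rintro ⟨a, ⟨ha, haS⟩, rfl⟩
          by_cases hax : a = x
          · subst hax; exact ⟨z, ⟨hne, hx'S⟩, hcx'⟩
          · exact ⟨a, ⟨hax, haS⟩, rfl⟩
        · rintro ⟨a, ⟨ha, haS⟩, rfl⟩
          by_cases hax : a = z
          · subst hax; exact ⟨x, ⟨hne.symm, hxS⟩, hcx'.symm⟩
          · exact ⟨a, ⟨hax, haS⟩, rfl⟩
  rw [this, Finset.card_pair hne.symm]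
  exact even_two

/-- A door lies in an even number of rooms if there are always candidates. -/
lemma sc_door {I V : Type} [Fintype I] [DecidableEq I] [Fintype V] [DecidableEq V]
    (r : I → V → ℕ) (hr : ∀ i, Function.Injective (r i)) (τ : Finset V)
    (hτ : τ.card + 1 = Fintype.card I) (hne : τ.Nonempty)
    (hM : ∀ k : I, ∃ y : V, ∀ l, l ≠ k → ∃ t ∈ τ, r l t < r l y)
    [DecidablePred (fun x => x ∉ τ ∧ ScDom r (insert x τ))] :
    Even ((Finset.univ.filter (fun x => x ∉ τ ∧ ScDom r (insert x τ))).card) := by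
  classical
  rcases Finset.eq_empty_or_nonempty
    (Finset.univ.filter (fun x => x ∉ τ ∧ ScDom r (insert x τ))) with h | ⟨x0, hx0⟩
  · rw [h]; simp
  simp only [Finset.mem_filter, Finset.mem_univ, true_and] at hx0
  obtain ⟨hx0τ, hx0⟩ := hx0
  have ha : ∀ l, ∃ a ∈ τ, ∀ x ∈ τ, r l a ≤ r l x := fun l => Finset.exists_min_image τ (r l) hne
  choose a haτ hamin using ha
  have hau : ∀ l t, t ∈ τ → (∀ x ∈ τ, r l t ≤ r l x) → t = a l := fun l t ht h =>
    hr l (le_antisymm (h _ (haτ l)) (hamin l t ht))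
  have hM' : ∀ k : I, ∃ y : V, ∀ l, l ≠ k → r l (a l) < r l y := by
    intro k
    obtain ⟨y, hy⟩ := hM k
    refine ⟨y, fun l hl => ?_⟩
    obtain ⟨t, ht, hlt⟩ := hy l hl
    exact (hamin l t ht).trans_lt hlt
  -- structure of a room containing the door
  have key : ∀ x, x ∉ τ → ScDom r (insert x τ) → ∃ k, (∀ t ∈ τ, r k x ≤ r k t) ∧
      (∀ t ∈ τ, ∃ l, l ≠ k ∧ t = a l ∧ r l t ≤ r l x) := by
    intro x hx hd
    obtain ⟨k, hk⟩ := hd x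
    refine ⟨k, fun t ht => hk t (Finset.mem_insert_of_mem ht), fun t ht => ?_⟩
    obtain ⟨l, hl⟩ := hd t
    refine ⟨l, ?_, hau l t ht (fun x hx => hl x (Finset.mem_insert_of_mem hx)),
      hl x (Finset.mem_insert_self _ _)⟩
    rintro rfl
    have : t = x := hr l (le_antisymm (hl x (Finset.mem_insert_self _ _))
      (hk t (Finset.mem_insert_of_mem ht)))
    exact hx (this ▸ ht)
  -- surjectivity off k implies injectivity off k
  have sinj : ∀ k, (∀ t ∈ τ, ∃ l, l ≠ k ∧ t = a l) →
      Set.InjOn a ((Finset.univ.erase k : Finset I) : Set I) := by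
    intro k hk
    apply Finset.injOn_of_card_image_eq
    have : (Finset.univ.erase k).image a = τ := by
      ext t
      simp only [Finset.mem_image, Finset.mem_erase, Finset.mem_univ, and_true]
      constructor
      · rintro ⟨l, -, rfl⟩; exact haτ l
      · intro ht
        obtain ⟨l, hl, h⟩ := hk t ht
        exact ⟨l, hl, h.symm⟩
    rw [this, Finset.card_erase_of_mem (Finset.mem_univ _), Finset.card_univ]
    omega
  obtain ⟨i, hi1, hi2⟩ := key x0 hx0τ hx0
  have hsi : ∀ t ∈ τ, ∃ l, l ≠ i ∧ t = a l := fun t ht => by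
    obtain ⟨l, h1, h2, -⟩ := hi2 t ht; exact ⟨l, h1, h2⟩
  obtain ⟨j, hji, hij⟩ := hsi (a i) (haτ i)
  have hsj : ∀ t ∈ τ, ∃ l, l ≠ j ∧ t = a l := fun t ht => by
    obtain ⟨l, h1, h2⟩ := hsi t ht
    by_cases hlj : l = j
    · exact ⟨i, hji.symm, by rw [h2, hlj, hij]⟩
    · exact ⟨l, hlj, h2⟩
  have hdτ : ScDom r τ := fun y => by
    obtain ⟨l, hl⟩ := hx0 y
    exact ⟨l, fun x hx => hl x (Finset.mem_insert_of_mem hx)⟩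
  have hMle : ∀ k y, (∀ l, l ≠ k → r l (a l) < r l y) → ∀ t ∈ τ, r k y ≤ r k t := by
    intro k y hy
    obtain ⟨l, hl⟩ := hdτ y
    by_cases hlk : l = k
    · subst hlk; exact hl
    · exact absurd (hl _ (haτ l)) (not_le.2 (hy l hlk))
  have hX : ∀ k, ∃ x, (∀ l, l ≠ k → r l (a l) < r l x) ∧
      ∀ y, (∀ l, l ≠ k → r l (a l) < r l y) → r k y ≤ r k x := by
    intro k
    obtain ⟨x, hx, hmax⟩ := Finset.exists_max_image
      (Finset.univ.filter (fun y => ∀ l, l ≠ k → r l (a l) < r l y)) (r k)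
      (by obtain ⟨y, hy⟩ := hM' k; exact ⟨y, by simpa using hy⟩)
    simp only [Finset.mem_filter, Finset.mem_univ, true_and] at hx hmax
    exact ⟨x, hx, hmax⟩
  choose X hXM hXmax using hX
  have hgood : ∀ k, (∀ t ∈ τ, ∃ l, l ≠ k ∧ t = a l) → X k ∉ τ ∧ ScDom r (insert (X k) τ) := by
    intro k hk
    constructor
    · intro hmem
      obtain ⟨l, hl, h⟩ := hk _ hmem
      have := hXM k l hl
      rw [h] at this
      exact lt_irrefl _ this
    · intro y
      by_cases hy : ∀ l, l ≠ k → r l (a l) < r l y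
      · refine ⟨k, fun x hx => ?_⟩
        rcases Finset.mem_insert.1 hx with rfl | hx
        · exact hXmax k y hy
        · exact hMle k y hy x hx
      · push Not at hy
        obtain ⟨l, hl, hly⟩ := hy
        refine ⟨l, fun x hx => ?_⟩
        rcases Finset.mem_insert.1 hx with rfl | hx
        · exact hly.trans (hXM k l hl).le
        · exact hly.trans (hamin l x hx)
  have hXne : X i ≠ X j := by
    intro h
    have h1 := hXM i j hji
    have h2 := hMle j (X j) (hXM j) (a j) (haτ j)
    rw [h] at h1
    omega
  have : Finset.univ.filter (fun x => x ∉ τ ∧ ScDom r (insert x τ)) = {X i, X j} := by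
    ext x
    simp only [Finset.mem_filter, Finset.mem_univ, true_and, Finset.mem_insert,
      Finset.mem_singleton]
    constructor
    · rintro ⟨hx, hd⟩
      obtain ⟨k, hk1, hk2⟩ := key x hx hd
      have hsk : ∀ t ∈ τ, ∃ l, l ≠ k ∧ t = a l := fun t ht => by
        obtain ⟨l, h1, h2, -⟩ := hk2 t ht; exact ⟨l, h1, h2⟩
      have hinj := sinj k hsk
      have hkij : k = i ∨ k = j := by
        by_contra hcon
        push Not at hcon
        apply hji
        apply hinj
        · simp [Ne.symm hcon.2]
        · simp [Ne.symm hcon.1]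
        · exact hij.symm
      have hxM : ∀ l, l ≠ k → r l (a l) < r l x := by
        intro l hl
        obtain ⟨l', hl', he, hle⟩ := hk2 (a l) (haτ l)
        have hll : l = l' := hinj (by simp [hl]) (by simp [hl']) he
        subst hll
        refine lt_of_le_of_ne hle (fun h => hx ?_)
        rw [← hr l h]; exact haτ l
      have hxX : x = X k := by
        apply hr k
        apply le_antisymm (hXmax k x hxM)
        obtain ⟨l, hl⟩ := hd (X k)
        by_cases hlk : l = k
        · subst hlk; exact hl x (Finset.mem_insert_self _ _)
        · exact absurd (hl _ (Finset.mem_insert_of_mem (haτ l))) (not_le.2 (hXM k l hlk))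
      rcases hkij with rfl | rfl
      · exact Or.inl hxX
      · exact Or.inr hxX
    · rintro (rfl | rfl)
      · exact hgood i hsi
      · exact hgood j hsj
  rw [this, Finset.card_pair hXne]
  exact even_two

/-- Parity count. -/
lemma sc_count {I V : Type} [Fintype I] [DecidableEq I] [Fintype V] [DecidableEq V]
    (R : Finset V → Prop) (c : V → I) (i0 : I) (τ0 : Finset V)
    (hτ0c : τ0.card + 1 = Fintype.card I) (hτ0 : τ0.image c = Finset.univ.erase i0)
    (hdoor : ∀ τ : Finset V, τ.card + 1 = Fintype.card I → τ.image c = Finset.univ.erase i0 →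
      τ ≠ τ0 → ∀ [DecidablePred (fun x => x ∉ τ ∧ R (insert x τ))],
      Even ((Finset.univ.filter (fun x => x ∉ τ ∧ R (insert x τ))).card))
    (hout : ∃! x, x ∉ τ0 ∧ R (insert x τ0)) :
    ∃ S : Finset V, S.card = Fintype.card I ∧ R S ∧ S.image c = Finset.univ := by
  classical
  by_contra hcon
  push Not at hcon
  let D : Finset (Finset V) := Finset.univ.filter
    (fun τ => τ.card + 1 = Fintype.card I ∧ τ.image c = Finset.univ.erase i0)
  let Q : Finset (Finset V) := Finset.univ.filter (fun S => S.card = Fintype.card I ∧ R S)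
  let A := D.sigma (fun τ => Finset.univ.filter (fun x => x ∉ τ ∧ R (insert x τ)))
  let B := Q.sigma (fun S => S.filter (fun x => (S.erase x).image c = Finset.univ.erase i0))
  have hAB : A.card = B.card := by
    refine Finset.card_bij' (fun p _ => ⟨insert p.2 p.1, p.2⟩) (fun p _ => ⟨p.1.erase p.2, p.2⟩)
      ?_ ?_ ?_ ?_
    · rintro ⟨τ, x⟩ h
      simp only [A, B, D, Q, Finset.mem_sigma, Finset.mem_filter, Finset.mem_univ, true_and]
        at h ⊢
      obtain ⟨⟨h1, h2⟩, h3, h4⟩ := h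
      refine ⟨⟨?_, h4⟩, Finset.mem_insert_self _ _, ?_⟩
      · rw [Finset.card_insert_of_notMem h3, h1]
      · rw [Finset.erase_insert h3, h2]
    · rintro ⟨S, x⟩ h
      simp only [A, B, D, Q, Finset.mem_sigma, Finset.mem_filter, Finset.mem_univ, true_and]
        at h ⊢
      obtain ⟨⟨h1, h2⟩, h3, h4⟩ := h
      refine ⟨⟨?_, h4⟩, Finset.notMem_erase _ _, ?_⟩
      · rw [Finset.card_erase_add_one h3, h1]
      · rw [Finset.insert_erase h3]; exact h2
    · rintro ⟨τ, x⟩ h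
      simp only [A, D, Finset.mem_sigma, Finset.mem_filter, Finset.mem_univ, true_and] at h
      simp [Finset.erase_insert h.2.1]
    · rintro ⟨S, x⟩ h
      simp only [B, Q, Finset.mem_sigma, Finset.mem_filter, Finset.mem_univ, true_and] at h
      simp [Finset.insert_erase h.2.1]
  have hB : Even B.card := by
    rw [Finset.card_sigma]
    apply Finset.even_sum
    intro S hS
    simp only [Q, Finset.mem_filter, Finset.mem_univ, true_and] at hS
    exact sc_room c i0 S hS.1 (hcon S hS.1 hS.2)
  have hA : Odd A.card := by
    have hmem : τ0 ∈ D := by simp [D, hτ0c, hτ0]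
    rw [Finset.card_sigma, ← Finset.add_sum_erase D _ hmem]
    apply Odd.add_even
    · obtain ⟨x, hx, hu⟩ := hout
      have : Finset.univ.filter (fun x => x ∉ τ0 ∧ R (insert x τ0)) = {x} := by
        ext z
        simp only [Finset.mem_filter, Finset.mem_univ, true_and, Finset.mem_singleton]
        exact ⟨fun h => hu z h, fun h => h ▸ hx⟩
      rw [this]; simp
    · apply Finset.even_sum
      intro τ hτ
      simp only [D, Finset.mem_erase, Finset.mem_filter, Finset.mem_univ, true_and] at hτ
      exact hdoor τ hτ.2.1 hτ.2.2 hτ.1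
  rw [hAB] at hA
  exact (Nat.not_even_iff_odd.2 hA) hB

/-- Scarf's lemma. -/
lemma sc_scarf {I T : Type} [Fintype I] [Fintype T] [Nonempty T]
    (hI : 2 ≤ Fintype.card I) (s : I → T → ℕ) (hs : ∀ i, Function.Injective (s i))
    (col : T → I) :
    ∃ (C : Finset I) (p : I → T), C.Nonempty ∧ (∀ i ∈ C, col (p i) = i) ∧
      ∀ y, ∃ i ∈ C, ∀ j ∈ C, s i y ≤ s i (p j) := by
  classical
  obtain ⟨b, hb⟩ : ∃ b : ℕ, ∀ i t, s i t < b := by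
    refine ⟨(∑ i, ∑ t, s i t) + 1, fun i t => Nat.lt_succ_of_le ?_⟩
    calc s i t ≤ ∑ t, s i t := Finset.single_le_sum (f := fun t => s i t)
            (fun _ _ => Nat.zero_le _) (Finset.mem_univ t)
      _ ≤ _ := Finset.single_le_sum (f := fun i => ∑ t, s i t)
            (fun _ _ => Nat.zero_le _) (Finset.mem_univ i)
  let e := Fintype.equivFin I
  let r : I → T ⊕ I → ℕ := fun l v => Sum.elim (fun t => s l t + 1)
    (fun k => if k = l then 0 else b + 1 + (e k : ℕ)) v
  have r1 : ∀ l t, r l (Sum.inl t) = s l t + 1 := fun l t => rfl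
  have r2 : ∀ l, r l (Sum.inr l) = 0 := fun l => by simp [r]
  have r3 : ∀ l k, k ≠ l → r l (Sum.inr k) = b + 1 + (e k : ℕ) := fun l k h => by simp [r, h]
  have hr : ∀ l, Function.Injective (r l) := by
    rintro l (t | k) (t' | k') h
    · rw [r1, r1] at h
      rw [hs l (Nat.succ_injective h)]
    · exfalso
      have := hb l t
      by_cases hk : k' = l
      · rw [hk, r1, r2] at h; omega
      · rw [r1, r3 _ _ hk] at h; omega
    · exfalso
      have := hb l t'
      by_cases hk : k = l
      · rw [hk, r1, r2] at h; omega
      · rw [r1, r3 _ _ hk] at h; omega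
    · by_cases hk : k = l <;> by_cases hk' : k' = l
      · rw [hk, hk']
      · rw [hk, r2, r3 _ _ hk'] at h; omega
      · rw [hk', r2, r3 _ _ hk] at h; omega
      · rw [r3 _ _ hk, r3 _ _ hk'] at h
        have : e k = e k' := Fin.ext (by omega)
        rw [e.injective this]
  let c : T ⊕ I → I := Sum.elim col id
  have hIne : Nonempty I := Fintype.card_pos_iff.1 (by omega)
  obtain ⟨i0⟩ := hIne
  let out : I → Finset (T ⊕ I) := fun l => (Finset.univ.erase l).image Sum.inr
  have hout_card : ∀ l, (out l).card + 1 = Fintype.card I := by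
    intro l
    rw [Finset.card_image_of_injective _ Sum.inr_injective,
      Finset.card_erase_of_mem (Finset.mem_univ _), Finset.card_univ]
    omega
  have hout_im : ∀ l, (out l).image c = Finset.univ.erase l := by
    intro l
    rw [Finset.image_image]
    exact Finset.image_id
  obtain ⟨S, hSc, hSd, hSi⟩ := sc_count (ScDom r) c i0 (out i0) (hout_card i0) (hout_im i0)
    (by
      intro τ hτc hτi hτ0 _
      refine sc_door r hr τ hτc (Finset.card_pos.1 (by omega)) (fun k => ⟨Sum.inr k, ?_⟩)
      intro l hl
      by_contra hcon
      push Not at hcon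
      have hsub : τ ⊆ out l := by
        rintro (t | j) hj
        · exfalso
          have := hcon _ hj
          rw [r1, r3 _ _ hl.symm] at this
          have := hb l t
          omega
        · have hjl : j ≠ l := by
            rintro rfl
            have := hcon _ hj
            rw [r2, r3 _ _ hl.symm] at this
            omega
          simp [out, hjl]
      have heq : τ = out l := Finset.eq_of_subset_of_card_le hsub (by
        have := hout_card l; omega)
      have h1 := hout_im l
      rw [← heq, hτi] at h1
      have : l = i0 := by
        by_contra hne
        have : l ∈ Finset.univ.erase i0 := by simp [hne]
        rw [h1] at this
        simp at this
      exact hτ0 (this ▸ heq))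
    (by
      obtain ⟨t, -, ht⟩ := Finset.exists_max_image (Finset.univ : Finset T) (s i0)
        Finset.univ_nonempty
      refine ⟨Sum.inl t, ⟨by simp [out], ?_⟩, ?_⟩
      · rintro (t' | k)
        · refine ⟨i0, fun x hx => ?_⟩
          rcases Finset.mem_insert.1 hx with rfl | hx
          · rw [r1, r1]; have := ht t' (Finset.mem_univ _); omega
          · simp only [out, Finset.mem_image, Finset.mem_erase, Finset.mem_univ, and_true] at hx
            obtain ⟨j, hj, rfl⟩ := hx
            rw [r1, r3 _ _ hj]
            have := hb i0 t'
            omega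
        · exact ⟨k, fun x _ => by rw [r2]; exact Nat.zero_le _⟩
      · rintro (t' | k) ⟨hx, hd⟩
        · obtain ⟨l, hl⟩ := hd (Sum.inl t)
          have hli : l = i0 := by
            by_contra hne
            have := hl (Sum.inr l) (Finset.mem_insert_of_mem (by simp [out, hne]))
            rw [r1, r2] at this
            omega
          subst hli
          have h1 := hl (Sum.inl t') (Finset.mem_insert_self _ _)
          rw [r1, r1] at h1
          have h2 := ht t' (Finset.mem_univ _)
          rw [hs l (show s l t' = s l t by omega)]
        · exfalso
          have hk : k = i0 := by
            by_contra hne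
            exact hx (by simp [out, hne])
          subst hk
          obtain ⟨l, hl⟩ := hd (Sum.inl t)
          have := hl (Sum.inr l) (by
            by_cases h : l = k
            · subst h; exact Finset.mem_insert_self _ _
            · exact Finset.mem_insert_of_mem (by simp [out, h]))
          rw [r1, r2] at this
          omega)
  have hp : ∀ i, ∃ t : T, Sum.inr i ∉ S → col t = i ∧ Sum.inl t ∈ S := by
    intro i
    have : i ∈ S.image c := by rw [hSi]; simp
    obtain ⟨v, hv, hvi⟩ := Finset.mem_image.1 this
    rcases v with t | k
    · exact ⟨t, fun _ => ⟨hvi, hv⟩⟩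
    · exact ⟨Classical.arbitrary T, fun h => absurd (show Sum.inr i ∈ S from hvi ▸ hv) h⟩
  choose p hp using hp
  have hy : ∀ y, ∃ i ∈ (Finset.univ.filter (fun i : I => (Sum.inr i : T ⊕ I) ∉ S)),
      ∀ j ∈ (Finset.univ.filter (fun i : I => (Sum.inr i : T ⊕ I) ∉ S)),
      s i y ≤ s i (p j) := by
    intro y
    obtain ⟨i, hi⟩ := hSd (Sum.inl y)
    refine ⟨i, ?_, ?_⟩
    · simp only [Finset.mem_filter, Finset.mem_univ, true_and]
      intro h
      have := hi _ h
      rw [r1, r2] at this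
      omega
    · intro j hj
      simp only [Finset.mem_filter, Finset.mem_univ, true_and] at hj
      have := hi _ (hp j hj).2
      rw [r1, r1] at this
      omega
  refine ⟨Finset.univ.filter (fun i => Sum.inr i ∉ S), p, ?_, ?_, hy⟩
  · obtain ⟨i, hi, -⟩ := hy (Classical.arbitrary T)
    exact ⟨i, hi⟩
  · intro i hi
    simp only [Finset.mem_filter, Finset.mem_univ, true_and] at hi
    exact (hp i hi).1

/-- Sperner-type lemma on the grid of the simplex. -/
lemma sc_grid {I : Type} [Fintype I] (hI : 2 ≤ Fintype.card I) (n : ℕ)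
    (col : (I → ℕ) → I) :
    ∃ (C : Finset I) (p : I → I → ℕ), C.Nonempty ∧ (∀ i ∈ C, col (p i) = i) ∧
      (∀ j, ∑ i, p j i = n) ∧
      (∀ j ∈ C, ∀ j' ∈ C, ∀ i, p j i ≤ p j' i + Fintype.card I) ∧
      (∀ j ∈ C, ∀ i, i ∉ C → p j i ≤ Fintype.card I) := by
  classical
  have hIne : Nonempty I := Fintype.card_pos_iff.1 (by omega)
  let T := {x : I → ℕ // x ∈ Finset.piAntidiag (Finset.univ : Finset I) n}
  have hT : ∀ x : T, ∑ i, x.1 i = n := fun x => (Finset.mem_piAntidiag.1 x.2).1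
  have mkT : ∀ x : I → ℕ, ∑ i, x i = n → ∃ t : T, t.1 = x := fun x hx =>
    ⟨⟨x, Finset.mem_piAntidiag.2 ⟨hx, by simp⟩⟩, rfl⟩
  haveI : Nonempty T := by
    obtain ⟨t, -⟩ := mkT (Pi.single (Classical.arbitrary I) n) (by simp)
    exact ⟨t⟩
  let e := Fintype.equivFin T
  have hs : ∀ i (x y : T), x.1 i * Fintype.card T + (e x : ℕ) ≤ y.1 i * Fintype.card T + (e y : ℕ) →
      x.1 i ≤ y.1 i := by
    intro i x y h
    by_contra hlt
    push Not at hlt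
    have h1 : (y.1 i + 1) * Fintype.card T ≤ x.1 i * Fintype.card T := Nat.mul_le_mul_right _ hlt
    have h2 := (e y).2
    rw [Nat.add_mul] at h1
    omega
  obtain ⟨C, p, hCne, hcol, hdom⟩ := sc_scarf hI
    (fun (i : I) (x : T) => x.1 i * Fintype.card T + (e x : ℕ))
    (by
      intro i x y h
      have h' : x.1 i * Fintype.card T + (e x : ℕ) = y.1 i * Fintype.card T + (e y : ℕ) := h
      have h1 := hs i x y h'.le
      have h2 := hs i y x h'.ge
      have h3 : x.1 i = y.1 i := le_antisymm h1 h2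
      rw [h3] at h'
      exact e.injective (Fin.ext (by omega)))
    (fun x => col x.1)
  have hm : ∀ i, ∃ m : ℕ, (∀ j ∈ C, m ≤ (p j).1 i) ∧ ∃ j ∈ C, (p j).1 i = m := by
    intro i
    obtain ⟨j, hj, hmin⟩ := Finset.exists_min_image C (fun j => (p j).1 i) hCne
    exact ⟨_, hmin, j, hj, rfl⟩
  choose m hm1 hm2 using hm
  have hsum : n < ∑ i ∈ C, (m i + 1) := by
    by_contra hle
    push Not at hle
    obtain ⟨i1, hi1⟩ := hCne
    obtain ⟨t, ht⟩ := mkT (fun i => (if i ∈ C then m i + 1 else 0) +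
        (if i = i1 then n - ∑ i ∈ C, (m i + 1) else 0)) (by
      rw [Finset.sum_add_distrib]
      simp only [Finset.sum_ite_mem, Finset.univ_inter, Finset.sum_ite_eq', Finset.mem_univ,
        if_true]
      omega)
    obtain ⟨i, hi, hle2⟩ := hdom t
    obtain ⟨j, hj, hjm⟩ := hm2 i
    have h1 := hs i _ _ (hle2 j hj)
    rw [ht, hjm] at h1
    simp only [hi, if_true] at h1
    omega
  have hCcard : C.card ≤ Fintype.card I := Finset.card_le_univ C
  rw [Finset.sum_add_distrib, Finset.sum_const, smul_eq_mul, mul_one] at hsum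
  have hsplit : ∀ j, ∑ i ∈ C, (p j).1 i + ∑ i ∈ Cᶜ, (p j).1 i = n := fun j => by
    rw [Finset.sum_add_sum_compl, hT]
  have hout : ∀ j ∈ C, ∀ i, i ∉ C → (p j).1 i ≤ Fintype.card I := by
    intro j hj i hi
    have h1 : (p j).1 i ≤ ∑ i ∈ Cᶜ, (p j).1 i :=
      Finset.single_le_sum (f := fun i => (p j).1 i) (fun _ _ => Nat.zero_le _)
        (Finset.mem_compl.2 hi)
    have h2 : ∑ i ∈ C, m i ≤ ∑ i ∈ C, (p j).1 i := Finset.sum_le_sum fun i _ => hm1 i j hj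
    have := hsplit j
    omega
  refine ⟨C, fun j => (p j).1, hCne, hcol, fun j => hT _, ?_, hout⟩
  intro j hj j' hj' i
  by_cases hi : i ∈ C
  · have h2 : ∑ i ∈ C.erase i, m i ≤ ∑ i ∈ C.erase i, (p j).1 i :=
      Finset.sum_le_sum fun i _ => hm1 i j hj
    have h3 := Finset.add_sum_erase C m hi
    have h4 := Finset.add_sum_erase C (fun i => (p j).1 i) hi
    have := hsplit j
    have := hm1 i j' hj'
    show (p j).1 i ≤ (p j').1 i + _
    omega
  · have := hout j hj i hi
    show (p j).1 i ≤ (p j').1 i + _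
    omega

/-- Brouwer's fixed point theorem on the standard simplex. -/
theorem sc_brouwer {I : Type} [Fintype I] [Nonempty I] (f : (I → ℝ) → (I → ℝ))
    (hf : ContinuousOn f (stdSimplex ℝ I)) (hmaps : Set.MapsTo f (stdSimplex ℝ I) (stdSimplex ℝ I)) :
    ∃ x ∈ stdSimplex ℝ I, f x = x := by
  classical
  have hK : IsCompact (stdSimplex ℝ I) := isCompact_stdSimplex ℝ I
  have hfix : ∀ x ∈ stdSimplex ℝ I, (∀ i, x i ≤ f x i) → f x = x := by
    intro x hx h
    have h1 : ∑ i, x i = ∑ i, f x i := by rw [hx.2, (hmaps hx).2]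
    have h2 := (Finset.sum_eq_sum_iff_of_le (fun i _ => h i)).1 h1
    funext i
    exact (h2 i (Finset.mem_univ i)).symm
  rcases Nat.lt_or_ge (Fintype.card I) 2 with hcard | hcard
  · have hsub : Subsingleton I := Fintype.card_le_one_iff_subsingleton.1 (by omega)
    let i0 : I := Classical.arbitrary I
    have hmem : (Pi.single i0 1 : I → ℝ) ∈ stdSimplex ℝ I := single_mem_stdSimplex ℝ i0
    have huniq : ∀ x ∈ stdSimplex ℝ I, ∀ i, x i = 1 := by
      intro x hx i
      have := hx.2
      rwa [Fintype.sum_subsingleton _ i] at this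
    refine ⟨_, hmem, funext fun i => ?_⟩
    rw [huniq _ (hmaps hmem), huniq _ hmem]
  -- approximate fixed points
  have happrox : ∀ ε > 0, ∃ x ∈ stdSimplex ℝ I, ∀ i, x i - ε ≤ f x i := by
    intro ε hε
    have hu := hK.uniformContinuousOn_of_continuous hf
    obtain ⟨δ, hδ, hu⟩ := Metric.uniformContinuousOn_iff.1 hu (ε / 2) (by positivity)
    obtain ⟨n, hn⟩ := exists_nat_gt ((Fintype.card I : ℝ) / (min δ (ε / 2)))
    have hmin : 0 < min δ (ε / 2) := lt_min hδ (by positivity)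
    have hn0 : (0 : ℝ) < n := lt_of_le_of_lt (by positivity) hn
    have hNn : (Fintype.card I : ℝ) / n < min δ (ε / 2) := by
      rw [div_lt_iff₀ hmin] at hn
      rw [div_lt_iff₀ hn0]
      linarith
    let pt : (I → ℕ) → (I → ℝ) := fun x i => (x i : ℝ) / n
    have hpt : ∀ x : I → ℕ, ∑ i, x i = n → pt x ∈ stdSimplex ℝ I := by
      intro x hx
      refine ⟨fun i => by positivity, ?_⟩
      simp only [pt]
      rw [← Finset.sum_div, ← Nat.cast_sum, hx]
      exact div_self hn0.ne'
    have hcol : ∀ x : I → ℕ, ∃ i, ∑ i, x i = n → pt x i ≤ f (pt x) i := by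
      intro x
      by_cases hx : ∑ i, x i = n
      · by_contra hcon
        push Not at hcon
        have h1 : ∑ i, f (pt x) i < ∑ i, pt x i :=
          Finset.sum_lt_sum_of_nonempty Finset.univ_nonempty (fun i _ => (hcon i).2)
        rw [(hpt x hx).2, (hmaps (hpt x hx)).2] at h1
        exact lt_irrefl _ h1
      · exact ⟨Classical.arbitrary I, fun h => absurd h hx⟩
    choose col hcol using hcol
    obtain ⟨C, p, ⟨j0, hj0⟩, hpc, hpn, hclose, hsmall⟩ := sc_grid hcard n col
    refine ⟨pt (p j0), hpt _ (hpn _), fun i => ?_⟩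
    by_cases hi : i ∈ C
    · have h1 := hcol (p i) (hpn i)
      rw [hpc i hi] at h1
      have hd : ∀ l, |pt (p j0) l - pt (p i) l| ≤ (Fintype.card I : ℝ) / n := by
        intro l
        have a1 : (p j0 l : ℝ) ≤ p i l + Fintype.card I := by
          exact_mod_cast hclose j0 hj0 i hi l
        have a2 : (p i l : ℝ) ≤ p j0 l + Fintype.card I := by
          exact_mod_cast hclose i hi j0 hj0 l
        simp only [pt]
        rw [← sub_div, abs_div, abs_of_pos hn0]
        apply div_le_div_of_nonneg_right _ hn0.le
        rw [abs_le]; constructor <;> linarith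
      have hdist : dist (pt (p j0)) (pt (p i)) < δ := by
        rw [dist_pi_lt_iff hδ]
        intro l
        rw [Real.dist_eq]
        exact (hd l).trans_lt (hNn.trans_le (min_le_left _ _))
      have h2 := hu _ (hpt _ (hpn j0)) _ (hpt _ (hpn i)) hdist
      have h3 := (dist_le_pi_dist (f (pt (p j0))) (f (pt (p i))) i).trans_lt h2
      rw [Real.dist_eq] at h3
      have h4 := abs_lt.1 h3
      have h5 := abs_le.1 (hd i)
      have h6 := min_le_right δ (ε / 2)
      linarith [h4.1, h5.2]
    · have h1 : pt (p j0) i ≤ (Fintype.card I : ℝ) / n := by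
        simp only [pt]
        apply div_le_div_of_nonneg_right _ hn0.le
        exact_mod_cast hsmall j0 hj0 i hi
      have h2 := (hmaps (hpt _ (hpn j0))).1 i
      have h6 := min_le_right δ (ε / 2)
      linarith
  choose x hxK hx using fun k : ℕ => happrox (1 / ((k : ℝ) + 1)) (by positivity)
  obtain ⟨a, haK, φ, hφ, hlim⟩ := hK.tendsto_subseq hxK
  refine ⟨a, haK, hfix a haK fun i => ?_⟩
  have h1 : Filter.Tendsto (fun k => f (x (φ k))) Filter.atTop (nhds (f a)) :=
    (hf a haK).tendsto.comp (tendsto_nhdsWithin_iff.2 ⟨hlim, Filter.Eventually.of_forall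
      fun k => hxK _⟩)
  have h2 : Filter.Tendsto (fun k => x (φ k) i - 1 / (((φ k : ℕ) : ℝ) + 1)) Filter.atTop
      (nhds (a i - 0)) :=
    ((tendsto_pi_nhds.1 hlim) i).sub
      ((tendsto_one_div_add_atTop_nhds_zero_nat (𝕜 := ℝ)).comp hφ.tendsto_atTop)
  rw [sub_zero] at h2
  exact le_of_tendsto_of_tendsto' h2 ((tendsto_pi_nhds.1 h1) i) fun k => hx (φ k) i

/-- Approximate Nash equilibria, quasi-concave payoffs. -/
lemma sc_nash_approx {n : ℕ} {E : Fin n → Type} [∀ i, NormedAddCommGroup (E i)]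
    [∀ i, NormedSpace ℝ (E i)] (U : ∀ i, Set (E i)) (hne : ∀ i, (U i).Nonempty)
    (hconv : ∀ i, Convex ℝ (U i)) (hcomp : ∀ i, IsCompact (U i))
    (F : Fin n → (∀ j, E j) → ℝ)
    (hF : ∀ i, ContinuousOn (F i) {u | ∀ j, u j ∈ U j})
    (hq : ∀ i u, (∀ j, u j ∈ U j) → ∀ a : ℝ,
      Convex ℝ {v | v ∈ U i ∧ a ≤ F i (Function.update u i v)}) (ε : ℝ) (hε : 0 < ε) :
    ∃ u, (∀ j, u j ∈ U j) ∧ ∀ i, ∀ v ∈ U i, F i (Function.update u i v) - ε ≤ F i u := by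
  classical
  set K : Set (∀ j, E j) := {u | ∀ j, u j ∈ U j} with hKdef
  have hK : IsCompact K := by
    have : K = Set.univ.pi U := by ext; simp [K]
    rw [this]; exact isCompact_univ_pi hcomp
  have hKconv : Convex ℝ K := by
    have : K = Set.univ.pi U := by ext; simp [K]
    rw [this]; exact convex_pi fun i _ => hconv i
  have hKne : K.Nonempty := ⟨fun j => (hne j).some, fun j => (hne j).some_mem⟩
  have hup : ∀ u ∈ K, ∀ i, ∀ v ∈ U i, Function.update u i v ∈ K := by
    intro u hu i v hv j
    by_cases h : j = i
    · subst h; simpa using hv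
    · simpa [h] using hu j
  -- best responses
  have hb : ∀ u, ∃ b ∈ K, u ∈ K → ∀ i, ∀ v ∈ U i,
      F i (Function.update u i v) ≤ F i (Function.update u i (b i)) := by
    intro u
    by_cases hu : u ∈ K
    · have : ∀ i, ∃ b ∈ U i, ∀ v ∈ U i,
          F i (Function.update u i v) ≤ F i (Function.update u i b) := by
        intro i
        have hc : ContinuousOn (fun v => F i (Function.update u i v)) (U i) :=
          (hF i).comp (continuous_const.update i continuous_id).continuousOn
            (fun v hv => hup u hu i v hv)
        obtain ⟨b, hb, hmax⟩ := (hcomp i).exists_isMaxOn (hne i) hc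
        exact ⟨b, hb, fun v hv => hmax hv⟩
      choose b hb1 hb2 using this
      exact ⟨b, hb1, fun _ => hb2⟩
    · exact ⟨hKne.some, hKne.some_mem, fun h => absurd h hu⟩
  choose b hbK hbm using hb
  -- common modulus of continuity
  have hδ : ∃ δ > 0, ∀ i, ∀ u ∈ K, ∀ u' ∈ K, dist u u' < δ → dist (F i u) (F i u') < ε / 2 := by
    have h1 : ∀ i, ∃ δ > 0, ∀ u ∈ K, ∀ u' ∈ K, dist u u' < δ → dist (F i u) (F i u') < ε / 2 :=
      fun i => Metric.uniformContinuousOn_iff.1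
        (hK.uniformContinuousOn_of_continuous (hF i)) (ε / 2) (by positivity)
    choose δ hδ0 hδ using h1
    obtain ⟨d, hd0, hd⟩ : ∃ d > 0, ∀ i, d ≤ δ i := by
      by_cases hn : Nonempty (Fin n)
      · obtain ⟨i, hi⟩ := Finite.exists_min δ
        exact ⟨δ i, hδ0 i, hi⟩
      · exact ⟨1, one_pos, fun i => absurd ⟨i⟩ hn⟩
    exact ⟨d, hd0, fun i u hu u' hu' h => hδ i u hu u' hu' (h.trans_le (hd i))⟩
  obtain ⟨δ, hδ0, hδ⟩ := hδ
  have hupd : ∀ (u u' : ∀ j, E j) i v, dist u u' < δ →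
      dist (Function.update u i v) (Function.update u' i v) < δ := by
    intro u u' i v h
    rw [dist_pi_lt_iff hδ0] at h ⊢
    intro j
    by_cases hj : j = i
    · subst hj; simpa using hδ0
    · simpa [hj] using h j
  -- finite net
  obtain ⟨N, y, hyK, hcov⟩ : ∃ (N : ℕ) (y : Fin N → ∀ j, E j), (∀ k, y k ∈ K) ∧
      ∀ u ∈ K, ∃ k, dist u (y k) < δ := by
    obtain ⟨t, htK, htf, ht⟩ := hK.finite_cover_balls hδ0
    haveI := htf.fintype
    let e := Fintype.equivFin t
    refine ⟨Fintype.card t, fun k => (e.symm k).1, fun k => htK (e.symm k).2, fun u hu => ?_⟩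
    obtain ⟨z, hz, hzu⟩ := Set.mem_iUnion₂.1 (ht hu)
    exact ⟨e ⟨z, hz⟩, by simpa using hzu⟩
  haveI : Nonempty (Fin N) := by
    obtain ⟨u, hu⟩ := hKne
    obtain ⟨k, -⟩ := hcov u hu
    exact ⟨k⟩
  let ψ : (∀ j, E j) → Fin N → ℝ := fun u k => max 0 (δ - dist u (y k))
  let L : (Fin N → ℝ) → ∀ j, E j := fun x => ∑ k, x k • b (y k)
  have hψ0 : ∀ u k, 0 ≤ ψ u k := fun u k => le_max_left _ _
  have hψs : ∀ u ∈ K, 0 < ∑ k, ψ u k := by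
    intro u hu
    obtain ⟨k, hk⟩ := hcov u hu
    exact Finset.sum_pos' (fun k _ => hψ0 u k)
      ⟨k, Finset.mem_univ k, lt_max_of_lt_right (by linarith)⟩
  have hLK : ∀ x ∈ stdSimplex ℝ (Fin N), L x ∈ K := fun x hx =>
    hKconv.sum_mem (fun k _ => hx.1 k) hx.2 (fun k _ => hbK _)
  have hLc : Continuous L := by
    apply continuous_finset_sum
    intro k _
    exact (continuous_apply k).smul continuous_const
  have hψc : ∀ k, Continuous fun x => ψ (L x) k := fun k =>
    continuous_const.max (continuous_const.sub (hLc.dist continuous_const))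
  obtain ⟨x, hx, hfx⟩ := sc_brouwer (fun x k => ψ (L x) k / ∑ k, ψ (L x) k)
    (by
      apply continuousOn_pi.2
      intro k
      apply ContinuousOn.div (hψc k).continuousOn
        (continuous_finset_sum _ fun k _ => hψc k).continuousOn
      intro x hx
      exact (hψs _ (hLK x hx)).ne')
    (by
      intro x hx
      refine ⟨fun k => div_nonneg (hψ0 _ _) (hψs _ (hLK x hx)).le, ?_⟩
      simp only
      rw [← Finset.sum_div]
      exact div_self (hψs _ (hLK x hx)).ne')
  have hu := hLK x hx
  refine ⟨L x, hu, fun i w hw => ?_⟩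
  have hmem : ∀ k, x k ≠ 0 → b (y k) i ∈
      {v | v ∈ U i ∧ F i (Function.update (L x) i w) - ε ≤ F i (Function.update (L x) i v)} := by
    intro k hk
    refine ⟨hbK _ i, ?_⟩
    have hd : dist (L x) (y k) < δ := by
      by_contra hge
      apply hk
      rw [← hfx]
      have : ψ (L x) k = 0 := max_eq_left (by linarith)
      simp [this]
    have h1 := hδ i _ (hup _ hu i w hw) _ (hup _ (hyK k) i w hw) (hupd _ _ i w hd)
    have h2 := hδ i _ (hup _ hu i _ (hbK (y k) i)) _ (hup _ (hyK k) i _ (hbK (y k) i))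
      (hupd _ _ i (b (y k) i) hd)
    have h3 := hbm (y k) (hyK k) i w hw
    rw [Real.dist_eq] at h1 h2
    linarith [(abs_lt.1 h1).2, (abs_lt.1 h2).1]
  have hsum : ∑ k ∈ Finset.univ.filter (fun k => x k ≠ 0), x k • b (y k) i ∈
      {v | v ∈ U i ∧ F i (Function.update (L x) i w) - ε ≤ F i (Function.update (L x) i v)} := by
    apply (hq i (L x) hu _).sum_mem (fun k _ => hx.1 k)
    · rw [Finset.sum_filter_ne_zero]; exact hx.2
    · intro k hk
      exact hmem k (Finset.mem_filter.1 hk).2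
  have heq : ∑ k ∈ Finset.univ.filter (fun k => x k ≠ 0), x k • b (y k) i = L x i := by
    simp only [L, Finset.sum_apply, Pi.smul_apply]
    apply Finset.sum_filter_of_ne
    intro k _ h h0
    apply h
    rw [h0, zero_smul]
  rw [heq] at hsum
  have := hsum.2
  rwa [Function.update_eq_self] at this

/-- Nash equilibria for quasi-concave continuous payoffs. -/
theorem sc_nash {n : ℕ} {E : Fin n → Type} [∀ i, NormedAddCommGroup (E i)]
    [∀ i, NormedSpace ℝ (E i)] (U : ∀ i, Set (E i)) (hne : ∀ i, (U i).Nonempty)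
    (hconv : ∀ i, Convex ℝ (U i)) (hcomp : ∀ i, IsCompact (U i))
    (F : Fin n → (∀ j, E j) → ℝ)
    (hF : ∀ i, ContinuousOn (F i) {u | ∀ j, u j ∈ U j})
    (hq : ∀ i u, (∀ j, u j ∈ U j) → ∀ a : ℝ,
      Convex ℝ {v | v ∈ U i ∧ a ≤ F i (Function.update u i v)}) :
    ∃ u, (∀ j, u j ∈ U j) ∧ ∀ i, ∀ v ∈ U i, F i (Function.update u i v) ≤ F i u := by
  set K : Set (∀ j, E j) := {u | ∀ j, u j ∈ U j} with hKdef
  have hK : IsCompact K := by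
    have : K = Set.univ.pi U := by ext; simp [K]
    rw [this]; exact isCompact_univ_pi hcomp
  choose x hxK hx using fun k : ℕ =>
    sc_nash_approx U hne hconv hcomp F hF hq (1 / ((k : ℝ) + 1)) (by positivity)
  have hxK' : ∀ k, x k ∈ K := hxK
  obtain ⟨a, haK, φ, hφ, hlim⟩ := hK.tendsto_subseq hxK'
  refine ⟨a, haK, fun i v hv => ?_⟩
  have hup : ∀ u ∈ K, Function.update u i v ∈ K := by
    intro u hu j
    by_cases h : j = i
    · subst h; simpa using hv
    · simpa [h] using hu j
  have h1 : Filter.Tendsto (fun k => F i (x (φ k))) Filter.atTop (nhds (F i a)) :=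
    (hF i a haK).tendsto.comp (tendsto_nhdsWithin_iff.2 ⟨hlim, Filter.Eventually.of_forall
      fun k => hxK _⟩)
  have h2 : Filter.Tendsto (fun k => F i (Function.update (x (φ k)) i v)) Filter.atTop
      (nhds (F i (Function.update a i v))) :=
    (hF i _ (hup a haK)).tendsto.comp (tendsto_nhdsWithin_iff.2
      ⟨(hlim.update i tendsto_const_nhds), Filter.Eventually.of_forall
      fun k => hup _ (hxK _)⟩)
  have h3 : Filter.Tendsto (fun k => F i (Function.update (x (φ k)) i v)
      - 1 / (((φ k : ℕ) : ℝ) + 1)) Filter.atTop (nhds (F i (Function.update a i v) - 0)) :=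
    h2.sub ((tendsto_one_div_add_atTop_nhds_zero_nat (𝕜 := ℝ)).comp hφ.tendsto_atTop)
  rw [sub_zero] at h3
  exact le_of_tendsto_of_tendsto' h3 h1 fun k => hx (φ k) i v hv



/-- Theorem 3.3 of the paper: existence of weighted open-loop
Pareto-Nash equilibria.
Each player `i ∈ Fin n` has a strategy set `U i`, a nonempty convex compact subset of
`C([t₀,t₁], ℝ^{m i})` with the sup norm, an interval-vector-valued payoff with endpoints
`Jl i k ≤ Ju i k`, and a weight vector `ω i` with positive entries.  If each weighted
interval payoff `⟨ωᵢ, Jᵢ⟩ = Σₖ ωₖⁱ Jₖⁱ` (endpoints `Σₖ ωₖⁱ Jl i k` and `Σₖ ωₖⁱ Ju i k`)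
is continuous on the product of the strategy sets and generalized `I(ℝ₊)`-quasi-concave
in the player's own strategy, then a weighted open-loop Pareto-Nash equilibrium `u*`
exists: each `u* i ∈ U i` and no unilateral deviation strictly dominates the weighted
interval payoff from below. -/
theorem stmt_3 (n : ℕ) (t₀ t₁ : ℝ) (ht : t₀ < t₁) (m d : Fin n → ℕ)
    (U : ∀ i : Fin n, Set C(Set.Icc t₀ t₁, EuclideanSpace ℝ (Fin (m i))))
    (hUne : ∀ i, (U i).Nonempty)
    (hUconv : ∀ i, Convex ℝ (U i))
    (hUcomp : ∀ i, IsCompact (U i))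
    (Jl Ju : ∀ i : Fin n, Fin (d i) →
      (∀ j : Fin n, C(Set.Icc t₀ t₁, EuclideanSpace ℝ (Fin (m j)))) → ℝ)
    (hJle : ∀ i k u, Jl i k u ≤ Ju i k u)
    (ω : ∀ i : Fin n, Fin (d i) → ℝ)
    (hω : ∀ i k, 0 < ω i k)
    (hcontl : ∀ i, ContinuousOn (fun u => ∑ k, ω i k * Jl i k u) {u | ∀ j, u j ∈ U j})
    (hcontu : ∀ i, ContinuousOn (fun u => ∑ k, ω i k * Ju i k u) {u | ∀ j, u j ∈ U j})
    (hqc : ∀ i : Fin n,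
      ∀ u : (∀ j : Fin n, C(Set.Icc t₀ t₁, EuclideanSpace ℝ (Fin (m j)))),
      (∀ j, u j ∈ U j) →
      ∀ x₁ ∈ U i, ∀ x₂ ∈ U i, ∀ al au : ℝ, al ≤ au →
      ∀ lam : ℝ, lam ∈ Set.Icc (0 : ℝ) 1 →
      (al ≤ ∑ k, ω i k * Jl i k (Function.update u i x₁) ∨
        au ≤ ∑ k, ω i k * Ju i k (Function.update u i x₁)) →
      (al ≤ ∑ k, ω i k * Jl i k (Function.update u i x₂) ∨
        au ≤ ∑ k, ω i k * Ju i k (Function.update u i x₂)) →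
      (al ≤ ∑ k, ω i k * Jl i k (Function.update u i (lam • x₁ + (1 - lam) • x₂)) ∨
        au ≤ ∑ k, ω i k * Ju i k (Function.update u i (lam • x₁ + (1 - lam) • x₂)))) :
    ∃ ustar : ∀ j : Fin n, C(Set.Icc t₀ t₁, EuclideanSpace ℝ (Fin (m j))),
      (∀ j, ustar j ∈ U j) ∧
      ∀ i : Fin n, ∀ v ∈ U i,
        (∑ k, ω i k * Jl i k (Function.update ustar i v) ≤ ∑ k, ω i k * Jl i k ustar) ∨
        (∑ k, ω i k * Ju i k (Function.update ustar i v) ≤ ∑ k, ω i k * Ju i k ustar) := by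
  obtain ⟨u, hu, h⟩ := sc_nash U hUne hUconv hUcomp (fun i u => ∑ k, ω i k * Jl i k u) hcontl (by
    intro i u hu a x hx y hy p q hp hq' hpq
    refine ⟨hUconv i hx.1 hy.1 hp hq' hpq, ?_⟩
    have hq1 : q = 1 - p := by linarith
    subst hq1
    have hex : ∃ au : ℝ, a ≤ au ∧
        ∑ k, ω i k * Ju i k (Function.update u i (p • x + (1 - p) • y)) < au :=
      ⟨max a (∑ k, ω i k * Ju i k (Function.update u i (p • x + (1 - p) • y)) + 1),
        le_max_left _ _, lt_max_of_lt_right (by linarith)⟩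
    obtain ⟨au, h1, h2⟩ := hex
    rcases hqc i u hu x hx.1 y hy.1 a au h1 p ⟨hp, by linarith⟩ (Or.inl hx.2) (Or.inl hy.2)
      with h3 | h3
    · exact h3
    · exact absurd h3 (not_le.2 h2))
  exact ⟨u, hu, fun i v hv => Or.inl (h i v hv)⟩
end

section
/- Let F = [f̲, f̄] : [t₀, t₁] → I(ℝ) be an interval-valued function (f̲ ≤ f̄ pointwise) that is gH-differentiable at a point t ∈ [t₀, t₁], i.e., both limits lim_{h→0} min( (f̲(t+h)−f̲(t))/h, (f̄(t+h)−f̄(t))/h ) and lim_{h→0} max( (f̲(t+h)−f̲(t))/h, (f̄(t+h)−f̄(t))/h ) exist (one-sided limits at the endpoints t₀, t₁). Then F is continuous at t; that is, both f̲ and f̄ are continuous at t. -/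
open Filter Topology in
theorem cont_of_quot_between (S : Set ℝ) (t : ℝ) (g m M : ℝ → ℝ) (a b : ℝ)
    (hm : Tendsto m (𝓝[{h : ℝ | t + h ∈ S ∧ h ≠ 0}] 0) (𝓝 a))
    (hM : Tendsto M (𝓝[{h : ℝ | t + h ∈ S ∧ h ≠ 0}] 0) (𝓝 b))
    (h1 : ∀ h, m h ≤ (g (t + h) - g t) / h)
    (h2 : ∀ h, (g (t + h) - g t) / h ≤ M h) :
    ContinuousWithinAt g S t := by
  have hid : Tendsto (fun h : ℝ => h) (𝓝[{h : ℝ | t + h ∈ S ∧ h ≠ 0}] 0) (𝓝 0) :=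
    tendsto_nhdsWithin_of_tendsto_nhds tendsto_id
  have e1 := hid.mul hm
  have e2 := hid.mul hM
  have lo := e1.min e2
  have hi := e1.max e2
  simp only [zero_mul, min_self, max_self] at lo hi
  have key : Tendsto (fun h => g (t + h) - g t) (𝓝[{h : ℝ | t + h ∈ S ∧ h ≠ 0}] 0) (𝓝 0) := by
    refine tendsto_of_tendsto_of_tendsto_of_le_of_le' lo hi ?_ ?_
    · filter_upwards [self_mem_nhdsWithin] with h hh
      have e : g (t + h) - g t = h * ((g (t + h) - g t) / h) := by
        have := hh.2
        field_simp
      rw [e]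
      rcases le_total 0 h with h0 | h0
      · exact (min_le_left _ _).trans (mul_le_mul_of_nonneg_left (h1 h) h0)
      · exact (min_le_right _ _).trans (mul_le_mul_of_nonpos_left (h2 h) h0)
    · filter_upwards [self_mem_nhdsWithin] with h hh
      have e : g (t + h) - g t = h * ((g (t + h) - g t) / h) := by
        have := hh.2
        field_simp
      rw [e]
      rcases le_total 0 h with h0 | h0
      · exact (mul_le_mul_of_nonneg_left (h2 h) h0).trans (le_max_right _ _)
      · exact (mul_le_mul_of_nonpos_left (h1 h) h0).trans (le_max_left _ _)
  rw [← continuousWithinAt_diff_self]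
  have sh : Tendsto (fun s => s - t) (𝓝[S \ {t}] t) (𝓝[{h : ℝ | t + h ∈ S ∧ h ≠ 0}] 0) := by
    refine tendsto_nhdsWithin_iff.2 ⟨?_, ?_⟩
    · have : Tendsto (fun s : ℝ => s - t) (𝓝 t) (𝓝 (t - t)) :=
        (continuous_id.sub continuous_const).tendsto t
      rw [sub_self] at this
      exact tendsto_nhdsWithin_of_tendsto_nhds this
    · filter_upwards [self_mem_nhdsWithin] with s hs
      refine ⟨?_, sub_ne_zero.2 hs.2⟩
      rw [add_sub_cancel]
      exact hs.1
  have := (key.comp sh).add_const (g t)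
  simpa [ContinuousWithinAt, Function.comp_def] using this

/-- Theorem 2.7 of the paper: gH-differentiability implies continuity.
Let `F = [fl, fu] : [t₀,t₁] → I(ℝ)` (with `fl ≤ fu` pointwise) be gH-differentiable at
`t ∈ [t₀,t₁]`: both the min and the max of the endpoint difference quotients
`Δ̲(h) = (fl(t+h) − fl(t))/h` and `Δ̄(h) = (fu(t+h) − fu(t))/h` converge as `h → 0`
within the set of admissible increments (`t + h ∈ [t₀,t₁]`, `h ≠ 0`; in particular
one-sided at the endpoints `t₀`, `t₁`).  Then `F` is continuous at `t`, i.e. both `fl`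
and `fu` are continuous at `t` within `[t₀,t₁]`. -/
theorem stmt_7 (t₀ t₁ : ℝ) (ht01 : t₀ < t₁) (t : ℝ) (ht : t ∈ Set.Icc t₀ t₁)
    (fl fu : ℝ → ℝ) (hle : ∀ s ∈ Set.Icc t₀ t₁, fl s ≤ fu s)
    (Dl Du : ℝ)
    (hDl : Filter.Tendsto
      (fun h : ℝ => min ((fl (t + h) - fl t) / h) ((fu (t + h) - fu t) / h))
      (nhdsWithin 0 {h : ℝ | t + h ∈ Set.Icc t₀ t₁ ∧ h ≠ 0}) (nhds Dl))
    (hDu : Filter.Tendsto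
      (fun h : ℝ => max ((fl (t + h) - fl t) / h) ((fu (t + h) - fu t) / h))
      (nhdsWithin 0 {h : ℝ | t + h ∈ Set.Icc t₀ t₁ ∧ h ≠ 0}) (nhds Du)) :
    ContinuousWithinAt fl (Set.Icc t₀ t₁) t ∧
      ContinuousWithinAt fu (Set.Icc t₀ t₁) t := by
  exact ⟨cont_of_quot_between _ t fl _ _ Dl Du hDl hDu
      (fun _ => min_le_left _ _) (fun _ => le_max_left _ _),
    cont_of_quot_between _ t fu _ _ Dl Du hDl hDu
      (fun _ => min_le_right _ _) (fun _ => le_max_right _ _)⟩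
end
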